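/- For every positive integer k there is a constant C = C(k) such that the following holds: every finite simple graph G with maximum degree Δ ≥ 4 whose average degree is at least C · log₂ log₂ Δ contains a nonempty k-regular subgraph. -/

import Mathlib

variable {V : Type*}

/-- `G` is a bipartite graph with parts `A` and `B`: the parts are disjoint, cover all
vertices, and every edge goes between `A` and `B`. -/
def BipartiteWith (G : SimpleGraph V) (A B : Set V) : Prop :=
  Disjoint A B ∧ A ∪ B = Set.univ ∧
    ∀ ⦃u v : V⦄, G.Adj u v → (u ∈ A ∧ v ∈ B) ∨ (u ∈ B ∧ v ∈ A)

/-- `G` contains no complete bipartite subgraph `K_{k,k}`. -/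
def KkkFree (G : SimpleGraph V) (k : ℕ) : Prop :=
  ¬ ∃ (S T : Finset V), Disjoint S T ∧ S.card = k ∧ T.card = k ∧
      ∀ u ∈ S, ∀ v ∈ T, G.Adj u v

/-- The number of edges of `G`. -/
noncomputable def edgeCount (G : SimpleGraph V) : ℕ := G.edgeSet.ncard

/-- The degree of `v` in `G`. -/
noncomputable def deg (G : SimpleGraph V) (v : V) : ℕ := (G.neighborSet v).ncard

/-- The codegree of `u` and `u'` in `G`: the number of their common neighbours. -/
noncomputable def codeg (G : SimpleGraph V) (u u' : V) : ℕ :=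
  (G.neighborSet u ∩ G.neighborSet u').ncard

/-- The average degree of `G`, as a real number. -/
noncomputable def avgDeg [Fintype V] (G : SimpleGraph V) : ℝ :=
  2 * (edgeCount G : ℝ) / (Fintype.card V : ℝ)

/-- The number of edges of a subgraph. -/
noncomputable def subEdgeCount {G : SimpleGraph V} (H : G.Subgraph) : ℕ := H.edgeSet.ncard

/-- The degree of a vertex in a subgraph. -/
noncomputable def subDeg {G : SimpleGraph V} (H : G.Subgraph) (v : V) : ℕ :=
  (H.neighborSet v).ncard

/-- The average degree of a subgraph. -/
noncomputable def subAvgDeg {G : SimpleGraph V} (H : G.Subgraph) : ℝ :=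
  2 * (subEdgeCount H : ℝ) / (H.verts.ncard : ℝ)

/-- A subgraph `H` is `K`-almost-regular: its maximum degree is at most `K` times its
minimum degree. -/
def SubAlmostRegular {G : SimpleGraph V} (H : G.Subgraph) (K : ℝ) : Prop :=
  ∀ v ∈ H.verts, ∀ w ∈ H.verts, (subDeg H v : ℝ) ≤ K * (subDeg H w : ℝ)

/-- `G` has a nonempty `k`-regular subgraph. -/
def HasRegularSubgraph (G : SimpleGraph V) (k : ℕ) : Prop :=
  ∃ H : G.Subgraph, H.verts.Nonempty ∧ ∀ v ∈ H.verts, subDeg H v = k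

/-- `G` has a nonempty `K`-almost-regular subgraph with average degree at least `c`. -/
def HasAlmostRegularSubgraph (G : SimpleGraph V) (K : ℝ) (c : ℝ) : Prop :=
  ∃ H : G.Subgraph, H.verts.Nonempty ∧ SubAlmostRegular H K ∧ c ≤ subAvgDeg H

/-- `G` is `(L, d)`-almost-biregular with parts `A` and `B`. -/
def IsAlmostBiregular (G : SimpleGraph V) (A B : Set V) (L : ℝ) (d : ℕ) : Prop :=
  BipartiteWith G A B ∧ A.Nonempty ∧
    (∀ v ∈ B, deg G v = d) ∧
    (d : ℝ) ≤ (edgeCount G : ℝ) / (A.ncard : ℝ) ∧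
    ∀ u ∈ A, (deg G u : ℝ) ≤ L * ((edgeCount G : ℝ) / (A.ncard : ℝ))

/-- A subgraph `H` of `G` is `(L, d)`-almost-biregular with parts `A` and `B`. -/
def SubIsAlmostBiregular {G : SimpleGraph V} (H : G.Subgraph) (A B : Set V)
    (L : ℝ) (d : ℕ) : Prop :=
  Disjoint A B ∧ A ∪ B = H.verts ∧
    (∀ ⦃u v : V⦄, H.Adj u v → (u ∈ A ∧ v ∈ B) ∨ (u ∈ B ∧ v ∈ A)) ∧
    A.Nonempty ∧
    (∀ v ∈ B, subDeg H v = d) ∧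
    (d : ℝ) ≤ (subEdgeCount H : ℝ) / (A.ncard : ℝ) ∧
    ∀ u ∈ A, (subDeg H u : ℝ) ≤ L * ((subEdgeCount H : ℝ) / (A.ncard : ℝ))

namespace ErdosSauer

open Finset

section Bipartite

variable {α β : Type*}

/-- The degree of the left vertex `a` in the bipartite graph with edge set `E`. -/
def leftDeg [DecidableEq α] (E : Finset (α × β)) (a : α) : ℕ := #{e ∈ E | e.1 = a}

/-- The degree of the right vertex `b` in the bipartite graph with edge set `E`. -/
def rightDeg [DecidableEq β] (E : Finset (α × β)) (b : β) : ℕ := #{e ∈ E | e.2 = b}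

lemma leftDeg_mono [DecidableEq α] {E F : Finset (α × β)} (h : F ⊆ E) (a : α) :
    leftDeg F a ≤ leftDeg E a :=
  card_le_card (filter_subset_filter _ h)

lemma rightDeg_mono [DecidableEq β] {E F : Finset (α × β)} (h : F ⊆ E) (b : β) :
    rightDeg F b ≤ rightDeg E b :=
  card_le_card (filter_subset_filter _ h)

lemma sum_leftDeg [DecidableEq α] {E : Finset (α × β)} {A : Finset α}
    (h : ∀ e ∈ E, e.1 ∈ A) :
    ∑ a ∈ A, leftDeg E a = #E :=
  (card_eq_sum_card_fiberwise h).symm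

lemma sum_rightDeg [DecidableEq β] {E : Finset (α × β)} {B : Finset β}
    (h : ∀ e ∈ E, e.2 ∈ B) :
    ∑ b ∈ B, rightDeg E b = #E :=
  (card_eq_sum_card_fiberwise h).symm

variable [DecidableEq α] [DecidableEq β]

lemma leftDeg_sdiff {E F : Finset (α × β)} (h : F ⊆ E) (a : α) :
    leftDeg (E \ F) a + leftDeg F a = leftDeg E a := by
  unfold leftDeg
  rw [← card_union_of_disjoint]
  · congr 1
    rw [← filter_union, sdiff_union_of_subset h]
  · exact disjoint_filter_filter sdiff_disjoint

lemma rightDeg_sdiff {E F : Finset (α × β)} (h : F ⊆ E) (b : β) :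
    rightDeg (E \ F) b + rightDeg F b = rightDeg E b := by
  unfold rightDeg
  rw [← card_union_of_disjoint]
  · congr 1
    rw [← filter_union, sdiff_union_of_subset h]
  · exact disjoint_filter_filter sdiff_disjoint

/-- A bipartite graph of maximum degree at most `R` has a matching containing at least a
`1 / R` fraction of its edges. -/
lemma exists_matching {E : Finset (α × β)} {R : ℕ} (hR : 0 < R)
    (hl : ∀ a, leftDeg E a ≤ R) (hr : ∀ b, rightDeg E b ≤ R) :
    ∃ M ⊆ E, (∀ a, leftDeg M a ≤ 1) ∧ (∀ b, rightDeg M b ≤ 1) ∧ #E ≤ R * #M := by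
  set B := E.image Prod.snd with hB
  have hEB : ∀ e ∈ E, e.2 ∈ B := fun e he => mem_image_of_mem _ he
  obtain ⟨c, hc1, hc2⟩ : ∃ c, #E ≤ R * c ∧ R * c < #E + R := by
    refine ⟨(#E + R - 1) / R, ?_, ?_⟩
    · have := Nat.div_add_mod (#E + R - 1) R
      have := Nat.mod_lt (#E + R - 1) hR
      omega
    · have := Nat.div_add_mod (#E + R - 1) R
      omega
  have hEn : #E ≤ R * #B := by
    rw [← sum_rightDeg hEB, mul_comm]
    exact sum_le_card_nsmul _ _ _ fun b _ => hr b
  have hcn : c ≤ #B := by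
    by_contra h
    have : R * (#B + 1) ≤ R * c := Nat.mul_le_mul_left _ (by omega)
    rw [mul_add] at this
    omega
  obtain ⟨d, hd⟩ := Nat.exists_eq_add_of_le hcn
  let N : β → Finset α := fun b => ({e ∈ E | e.2 = b}).image Prod.fst
  have hN : ∀ a b, a ∈ N b ↔ (a, b) ∈ E := by
    intro a b
    simp [N]
  let t : {b // b ∈ B} → Finset (α ⊕ Fin d) := fun b => (N b).disjSum univ
  obtain ⟨f, hfinj, hft⟩ :
      ∃ f : {b // b ∈ B} → α ⊕ Fin d, Function.Injective f ∧ ∀ x, f x ∈ t x := by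
    rw [← Finset.all_card_le_biUnion_card_iff_exists_injective]
    intro S
    rcases S.eq_empty_or_nonempty with rfl | ⟨b₀, hb₀⟩
    · simp
    set NS : Finset α := S.biUnion fun b => N b with hNS
    have hsub : NS.disjSum univ ⊆ S.biUnion t := by
      intro x hx
      rcases x with a | i
      · simp only [inl_mem_disjSum, hNS, mem_biUnion] at hx
        obtain ⟨b, hb, hab⟩ := hx
        exact mem_biUnion.2 ⟨b, hb, by simpa [t] using hab⟩
      · exact mem_biUnion.2 ⟨b₀, hb₀, by simp [t]⟩
    have h1 : #NS + d ≤ #(S.biUnion t) := by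
      simpa using card_le_card hsub
    refine le_trans ?_ h1
    set S' : Finset β := S.map (Function.Embedding.subtype _) with hS'
    have hS'B : S' ⊆ B := by
      intro b hb
      simp only [hS', mem_map, Function.Embedding.coe_subtype] at hb
      obtain ⟨x, _, rfl⟩ := hb
      exact x.2
    have hcS : #S' = #S := card_map _
    have h2 : #{e ∈ E | e.2 ∈ S'} ≤ R * #NS := by
      have hmem : ∀ e ∈ ({e ∈ E | e.2 ∈ S'} : Finset (α × β)), e.1 ∈ NS := by
        intro e he
        simp only [mem_filter, hS', mem_map, Function.Embedding.coe_subtype] at he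
        obtain ⟨he, x, hx, hxe⟩ := he
        refine mem_biUnion.2 ⟨x, hx, ?_⟩
        rw [hN, hxe]
        exact he
      rw [← sum_leftDeg hmem, mul_comm]
      exact sum_le_card_nsmul _ _ _ fun a _ =>
        (leftDeg_mono (filter_subset _ _) a).trans (hl a)
    have h3 : #{e ∈ E | e.2 ∉ S'} ≤ R * (#B - #S') := by
      have hmem : ∀ e ∈ ({e ∈ E | e.2 ∉ S'} : Finset (α × β)), e.2 ∈ B \ S' := by
        intro e he
        rw [mem_filter] at he
        exact mem_sdiff.2 ⟨hEB e he.1, he.2⟩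
      rw [← card_sdiff_of_subset hS'B, ← sum_rightDeg hmem, mul_comm]
      exact sum_le_card_nsmul _ _ _ fun a _ =>
        (rightDeg_mono (filter_subset _ _) a).trans (hr a)
    have h4 : #{e ∈ E | e.2 ∈ S'} + #{e ∈ E | e.2 ∉ S'} = #E :=
      card_filter_add_card_filter_not _
    have h5 : #S' ≤ #B := card_le_card hS'B
    obtain ⟨x, hx⟩ := Nat.exists_eq_add_of_le h5
    rw [hx, Nat.add_sub_cancel_left] at h3
    rw [← hcS]
    by_contra hcon
    have h6 : R * (#NS + x + 1) ≤ R * c := Nat.mul_le_mul_left _ (by omega)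
    rw [mul_add, mul_add] at h6
    omega
  refine ⟨{e ∈ E | ∃ h : e.2 ∈ B, f ⟨e.2, h⟩ = Sum.inl e.1}, filter_subset _ _, ?_, ?_, ?_⟩
  · intro a
    refine card_le_one.2 ?_
    rintro ⟨a₁, b₁⟩ h₁ ⟨a₂, b₂⟩ h₂
    simp only [mem_filter] at h₁ h₂
    obtain ⟨⟨_, hb₁, h₁⟩, rfl⟩ := h₁
    obtain ⟨⟨_, hb₂, h₂⟩, rfl⟩ := h₂
    have := hfinj (h₁.trans h₂.symm)
    simp only [Subtype.mk.injEq] at this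
    rw [this]
  · intro b
    refine card_le_one.2 ?_
    rintro ⟨a₁, b₁⟩ h₁ ⟨a₂, b₂⟩ h₂
    simp only [mem_filter] at h₁ h₂
    obtain ⟨⟨_, hb₁, h₁⟩, rfl⟩ := h₁
    obtain ⟨⟨_, hb₂, h₂⟩, rfl⟩ := h₂
    have := Sum.inl_injective (h₁.symm.trans h₂)
    rw [this]
  · refine hc1.trans (Nat.mul_le_mul_left _ ?_)
    have hcard : Fintype.card {b // b ∈ B} = #B := Fintype.card_coe B
    have hsub : (univ : Finset {b // b ∈ B}).image f ⊆
        (({e ∈ E | ∃ h : e.2 ∈ B, f ⟨e.2, h⟩ = Sum.inl e.1}).image Prod.fst).disjSum univ := by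
      intro y hy
      obtain ⟨b, _, rfl⟩ := mem_image.1 hy
      have hb := hft b
      rcases hfb : f b with a | i
      · simp only [hfb, t, inl_mem_disjSum, hN] at hb
        simp only [inl_mem_disjSum, mem_image, mem_filter]
        exact ⟨(a, b), ⟨hb, b.2, hfb⟩, rfl⟩
      · simp
    have := card_le_card hsub
    rw [card_image_of_injective _ hfinj, card_univ, hcard, card_disjSum, card_univ,
      Fintype.card_fin] at this
    have h7 := card_image_le (s := {e ∈ E | ∃ h : e.2 ∈ B, f ⟨e.2, h⟩ = Sum.inl e.1})
      (f := Prod.fst)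
    omega

/-- Greedy unions of `s` large matchings in a bipartite graph of maximum degree at most `R`. -/
lemma exists_bounded_degree_subgraph {E : Finset (α × β)} {R : ℕ} (hR : 0 < R)
    (hl : ∀ a, leftDeg E a ≤ R) (hr : ∀ b, rightDeg E b ≤ R) {B : Finset β}
    (hB : ∀ e ∈ E, e.2 ∈ B) (s : ℕ) :
    ∃ F ⊆ E, (∀ a, leftDeg F a ≤ s) ∧ (∀ b, rightDeg F b ≤ s) ∧
      s * #E ≤ R * #F + s ^ 2 * #B := by
  induction s with
  | zero => exact ⟨∅, empty_subset _, by simp [leftDeg], by simp [rightDeg], by simp⟩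
  | succ s ih =>
    obtain ⟨F, hFE, hFl, hFr, hF⟩ := ih
    obtain ⟨M, hM, hMl, hMr, hMc⟩ := exists_matching (E := E \ F) hR
      (fun a => (leftDeg_mono sdiff_subset a).trans (hl a))
      (fun b => (rightDeg_mono sdiff_subset b).trans (hr b))
    have hdisj : Disjoint F M := disjoint_of_subset_right hM disjoint_sdiff
    refine ⟨F ∪ M, union_subset hFE (hM.trans sdiff_subset), ?_, ?_, ?_⟩
    · intro a
      unfold leftDeg
      rw [filter_union]
      exact (card_union_le _ _).trans (Nat.add_le_add (hFl a) (hMl a))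
    · intro a
      unfold rightDeg
      rw [filter_union]
      exact (card_union_le _ _).trans (Nat.add_le_add (hFr a) (hMr a))
    · rw [card_union_of_disjoint hdisj]
      have h1 : #F ≤ s * #B := by
        rw [← sum_rightDeg fun e he => hB e (hFE he), mul_comm]
        exact sum_le_card_nsmul _ _ _ fun b _ => hFr b
      have h2 := card_sdiff_add_card_eq_card hFE
      nlinarith

/-- A nonempty bipartite graph whose nonisolated vertices all have degree `k`. -/
def IsBiregular (E : Finset (α × β)) (k : ℕ) : Prop :=
  E.Nonempty ∧ ∀ e ∈ E, leftDeg E e.1 = k ∧ rightDeg E e.2 = k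

lemma IsBiregular.exists_pred {E : Finset (α × β)} {k : ℕ} (h : IsBiregular E (k + 1))
    (hk : 0 < k) : ∃ F ⊆ E, IsBiregular F k := by
  obtain ⟨hne, hE⟩ := h
  have hle : ∀ a, leftDeg E a ≤ k + 1 := by
    intro a
    by_cases ha : ∃ e ∈ E, e.1 = a
    · obtain ⟨e, he, rfl⟩ := ha
      exact (hE e he).1.le
    · push Not at ha
      simp [leftDeg, filter_false_of_mem ha]
  have hre : ∀ b, rightDeg E b ≤ k + 1 := by
    intro a
    by_cases ha : ∃ e ∈ E, e.2 = a
    · obtain ⟨e, he, rfl⟩ := ha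
      exact (hE e he).2.le
    · push Not at ha
      simp [rightDeg, filter_false_of_mem ha]
  obtain ⟨M, hM, hMl, hMr, hMc⟩ := exists_matching (Nat.succ_pos k) hle hre
  have hA : #E = #(E.image Prod.fst) * (k + 1) := by
    rw [← sum_leftDeg (E := E) (A := E.image Prod.fst) fun e he => mem_image_of_mem _ he,
      ← smul_eq_mul, ← sum_const]
    refine sum_congr rfl fun a ha => ?_
    obtain ⟨e, he, rfl⟩ := mem_image.1 ha
    exact (hE e he).1
  have hB : #E = #(E.image Prod.snd) * (k + 1) := by
    rw [← sum_rightDeg (E := E) (B := E.image Prod.snd) fun e he => mem_image_of_mem _ he,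
      ← smul_eq_mul, ← sum_const]
    refine sum_congr rfl fun a ha => ?_
    obtain ⟨e, he, rfl⟩ := mem_image.1 ha
    exact (hE e he).2
  have hMA : ∀ e ∈ E, leftDeg M e.1 = 1 := by
    have h1 : ∑ a ∈ E.image Prod.fst, leftDeg M a = ∑ a ∈ E.image Prod.fst, 1 := by
      refine le_antisymm (sum_le_sum fun a _ => hMl a) ?_
      rw [sum_leftDeg fun e he => mem_image_of_mem _ (hM he), sum_const, smul_eq_mul, mul_one]
      refine Nat.le_of_mul_le_mul_left ?_ (Nat.succ_pos k)
      rw [mul_comm, ← hA]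
      exact hMc
    intro e he
    exact (sum_eq_sum_iff_of_le fun a _ => hMl a).1 h1 _ (mem_image_of_mem _ he)
  have hMB : ∀ e ∈ E, rightDeg M e.2 = 1 := by
    have h1 : ∑ a ∈ E.image Prod.snd, rightDeg M a = ∑ a ∈ E.image Prod.snd, 1 := by
      refine le_antisymm (sum_le_sum fun a _ => hMr a) ?_
      rw [sum_rightDeg fun e he => mem_image_of_mem _ (hM he), sum_const, smul_eq_mul, mul_one]
      refine Nat.le_of_mul_le_mul_left ?_ (Nat.succ_pos k)
      rw [mul_comm, ← hB]
      exact hMc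
    intro e he
    exact (sum_eq_sum_iff_of_le fun a _ => hMr a).1 h1 _ (mem_image_of_mem _ he)
  refine ⟨E \ M, sdiff_subset, ?_, ?_⟩
  · obtain ⟨e, he⟩ := hne
    have h1 := leftDeg_sdiff hM e.1
    rw [hMA e he, (hE e he).1] at h1
    have h2 : 0 < leftDeg (E \ M) e.1 := by omega
    obtain ⟨x, hx⟩ := card_pos.1 h2
    exact ⟨x, (mem_filter.1 hx).1⟩
  · intro e he
    have he' := sdiff_subset he
    have h1 := leftDeg_sdiff hM e.1
    have h2 := rightDeg_sdiff hM e.2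
    rw [hMA e he', (hE e he').1] at h1
    rw [hMB e he', (hE e he').2] at h2
    omega

/-- A `q`-regular bipartite graph contains a `k`-regular one for all `1 ≤ k ≤ q`. -/
lemma IsBiregular.exists_le {k q : ℕ} (hk : 0 < k) (hkq : k ≤ q) :
    ∀ {E : Finset (α × β)}, IsBiregular E q → ∃ F ⊆ E, IsBiregular F k := by
  induction q, hkq using Nat.le_induction with
  | base => exact fun h => ⟨_, Subset.rfl, h⟩
  | succ q hq ih =>
    intro E h
    obtain ⟨F, hF, h'⟩ := h.exists_pred (by omega)
    obtain ⟨F', hF', hreg⟩ := ih h'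
    exact ⟨F', hF'.trans hF, hreg⟩

/-- Alon–Friedland–Kalai: a bipartite graph of maximum degree at most `2q - 1` and average degree
greater than `2q - 2`, with `q` prime, contains a `q`-regular subgraph. -/
lemma exists_isBiregular_of_prime {q : ℕ} (hq : q.Prime) {E : Finset (α × β)} {A : Finset α}
    {B : Finset β} (hA : ∀ e ∈ E, e.1 ∈ A) (hB : ∀ e ∈ E, e.2 ∈ B)
    (hl : ∀ a, leftDeg E a < 2 * q) (hr : ∀ b, rightDeg E b < 2 * q)
    (hcard : (q - 1) * (#A + #B) < #E) : ∃ F ⊆ E, IsBiregular F q := by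
  have : Fact q.Prime := ⟨hq⟩
  let P : Finset E → MvPolynomial E (ZMod q) := fun S => ∑ e ∈ S, MvPolynomial.X e ^ (q - 1)
  have hP : ∀ S, (P S).totalDegree ≤ q - 1 := by
    intro S
    refine MvPolynomial.totalDegree_finsetSum_le fun e _ => ?_
    exact (MvPolynomial.totalDegree_pow _ _).trans (by simp)
  let f : α ⊕ β → MvPolynomial E (ZMod q) :=
    Sum.elim (fun a => P {e | e.1.1 = a}) (fun b => P {e | e.1.2 = b})
  have hdeg : ∑ i ∈ A.disjSum B, (f i).totalDegree < Fintype.card E := by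
    rw [Fintype.card_coe]
    refine lt_of_le_of_lt ?_ hcard
    rw [mul_comm, ← card_disjSum]
    refine sum_le_card_nsmul _ _ _ fun i _ => ?_
    rcases i with a | b
    · exact hP _
    · exact hP _
  have hdvd := char_dvd_card_solutions_of_sum_lt q hdeg
  obtain ⟨x, hx, hx0⟩ : ∃ x : E → ZMod q,
      (∀ i ∈ A.disjSum B, MvPolynomial.eval x (f i) = 0) ∧ x ≠ 0 := by
    have hzero : ∀ i ∈ A.disjSum B, MvPolynomial.eval (0 : E → ZMod q) (f i) = 0 := by
      have hq1 : q - 1 ≠ 0 := by have := hq.two_le; omega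
      rintro (a | b) _ <;> simp [f, P, hq1]
    have hpos : 0 < Fintype.card
        {x : E → ZMod q // ∀ i ∈ A.disjSum B, MvPolynomial.eval x (f i) = 0} :=
      Fintype.card_pos_iff.2 ⟨⟨0, hzero⟩⟩
    have h1 := lt_of_lt_of_le hq.one_lt (Nat.le_of_dvd hpos hdvd)
    obtain ⟨y, hy⟩ := Fintype.exists_ne_of_one_lt_card h1 ⟨0, hzero⟩
    exact ⟨y.1, y.2, fun h => hy (Subtype.ext h)⟩
  have hP' : ∀ S : Finset E, MvPolynomial.eval x (P S) = (#{e ∈ S | x e ≠ 0} : ZMod q) := by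
    intro S
    simp only [P, map_sum, map_pow, MvPolynomial.eval_X]
    rw [card_filter, Nat.cast_sum]
    refine sum_congr rfl fun e _ => ?_
    by_cases h : x e = 0
    · have hq1 : q - 1 ≠ 0 := by have := hq.two_le; omega
      simp [h, hq1]
    · simp [h, ZMod.pow_card_sub_one_eq_one h]
  set F : Finset (α × β) := ({e : E | x e ≠ 0} : Finset E).map (Function.Embedding.subtype _)
    with hF
  have hFE : F ⊆ E := by
    intro e he
    simp only [hF, mem_map, Function.Embedding.coe_subtype] at he
    obtain ⟨y, _, rfl⟩ := he
    exact y.2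
  have hmain : ∀ n, 0 < n → n < 2 * q → ((n : ℕ) : ZMod q) = 0 → n = q := by
    intro n hn0 hn hz
    rw [ZMod.natCast_eq_zero_iff] at hz
    obtain ⟨c, rfl⟩ := hz
    have : c < 2 := by
      by_contra h
      have : q * 2 ≤ q * c := Nat.mul_le_mul_left _ (by omega)
      omega
    have : c ≠ 0 := by rintro rfl; simp at hn0
    have : c = 1 := by omega
    simp [this]
  refine ⟨F, hFE, ?_, ?_⟩
  · obtain ⟨e, he⟩ := Function.ne_iff.1 hx0
    exact ⟨e.1, by simpa [hF] using he⟩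
  · intro e he
    constructor
    · refine hmain _ (card_pos.2 ⟨e, by simp [he]⟩)
        ((leftDeg_mono hFE _).trans_lt (hl _)) ?_
      have h1 := hx (Sum.inl e.1) (by simpa using hA e (hFE he))
      simp only [f, Sum.elim_inl, hP'] at h1
      rw [← h1]
      unfold leftDeg
      congr 1
      rw [hF, filter_map, card_map, filter_filter, filter_filter]
      congr 1
      ext y
      simp [and_comm]
    · refine hmain _ (card_pos.2 ⟨e, by simp [he]⟩)
        ((rightDeg_mono hFE _).trans_lt (hr _)) ?_
      have h1 := hx (Sum.inr e.2) (by simpa using hB e (hFE he))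
      simp only [f, Sum.elim_inr, hP'] at h1
      rw [← h1]
      unfold rightDeg
      congr 1
      rw [hF, filter_map, card_map, filter_filter, filter_filter]
      congr 1
      ext y
      simp [and_comm]

/-- A bipartite graph of maximum degree at most `R` whose average degree is close enough to `R`
contains a `k`-regular subgraph. -/
lemma exists_isBiregular_of_nearly_regular {k q R : ℕ} (hq : q.Prime) (hk : 0 < k) (hkq : k ≤ q)
    (hR : 4 * (2 * q - 1) ^ 2 ≤ R) {E : Finset (α × β)} {A : Finset α} {B : Finset β}
    (hA : ∀ e ∈ E, e.1 ∈ A) (hB : ∀ e ∈ E, e.2 ∈ B)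
    (hl : ∀ a, leftDeg E a ≤ R) (hr : ∀ b, rightDeg E b ≤ R)
    (hcard : (2 * (2 * q - 1) - 1) * R * (#A + #B) < 4 * (2 * q - 1) * #E) :
    ∃ F ⊆ E, IsBiregular F k := by
  obtain ⟨r, rfl⟩ : ∃ r, q = r + 1 := ⟨q - 1, by have := hq.two_le; omega⟩
  have e1 : 2 * (r + 1) - 1 = 2 * r + 1 := by omega
  have e2 : 2 * (2 * r + 1) - 1 = 4 * r + 1 := by omega
  rw [e1, e2] at hcard
  rw [e1] at hR
  have hR0 : 0 < R := lt_of_lt_of_le (by positivity) hR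
  obtain ⟨F, hF, hFl, hFr, hFc⟩ := exists_bounded_degree_subgraph hR0 hl hr hB (2 * r + 1)
  have hlt : R * (r * (#A + #B)) < R * #F := by
    have h1 : 4 * (2 * r + 1) ^ 2 * (#A + #B) ≤ R * (#A + #B) := Nat.mul_le_mul_right _ hR
    have h2 : 0 ≤ (2 * r + 1) ^ 2 * #A := Nat.zero_le _
    nlinarith
  obtain ⟨F', hF', h'⟩ := exists_isBiregular_of_prime hq (E := F) (A := A) (B := B)
    (fun e he => hA e (hF he)) (fun e he => hB e (hF he))
    (fun a => by have := hFl a; omega) (fun a => by have := hFr a; omega)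
    (by simpa using Nat.lt_of_mul_lt_mul_left hlt)
  obtain ⟨F'', hF'', hreg⟩ := h'.exists_le hk hkq
  exact ⟨F'', hF''.trans (hF'.trans hF), hreg⟩

section Expectation

variable {ι : Type*} [Fintype ι] [DecidableEq ι]

/-- The expectation of `F` on the random set containing each `i` independently with
probability `p i`. -/
noncomputable def expect (p : ι → ℝ) (F : Finset ι → ℝ) : ℝ :=
  ∑ ω : Finset ι, ((∏ i ∈ ω, p i) * ∏ i ∈ univ \ ω, (1 - p i)) * F ω

lemma expect_add (p : ι → ℝ) (F G : Finset ι → ℝ) :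
    expect p (fun ω => F ω + G ω) = expect p F + expect p G := by
  simp [expect, mul_add, sum_add_distrib]

lemma expect_sub (p : ι → ℝ) (F G : Finset ι → ℝ) :
    expect p (fun ω => F ω - G ω) = expect p F - expect p G := by
  simp [expect, mul_sub, sum_sub_distrib]

lemma expect_const_mul (p : ι → ℝ) (c : ℝ) (F : Finset ι → ℝ) :
    expect p (fun ω => c * F ω) = c * expect p F := by
  rw [expect, expect, mul_sum]
  exact sum_congr rfl fun _ _ => by ring

lemma expect_sum {κ : Type*} (p : ι → ℝ) (s : Finset κ) (F : κ → Finset ι → ℝ) :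
    expect p (fun ω => ∑ j ∈ s, F j ω) = ∑ j ∈ s, expect p (F j) := by
  simp only [expect, mul_sum]
  exact sum_comm

lemma expect_subset (p : ι → ℝ) (W : Finset ι) :
    expect p (fun ω => if W ⊆ ω then 1 else 0) = ∏ i ∈ W, p i := by
  have h := prod_add p (fun i => (1 - p i) * if i ∈ W then 0 else 1) univ
  have h1 : ∏ i, (p i + (1 - p i) * if i ∈ W then 0 else 1) = ∏ i ∈ W, p i := by
    rw [← prod_subset (subset_univ W)]
    · exact prod_congr rfl fun i hi => by simp [hi]
    · intro i _ hi
      simp [hi]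
  rw [← h1, h, expect, powerset_univ]
  refine sum_congr rfl fun ω _ => ?_
  rw [prod_mul_distrib, mul_assoc]
  congr 2
  by_cases hW : W ⊆ ω
  · rw [if_pos hW, prod_eq_one]
    intro i hi
    rw [if_neg fun h => (mem_sdiff.1 hi).2 (hW h)]
  · rw [if_neg hW]
    obtain ⟨i, hi, hiω⟩ := not_subset.1 hW
    symm
    refine prod_eq_zero (i := i) (mem_sdiff.2 ⟨mem_univ i, hiω⟩) ?_
    rw [if_pos hi]

lemma expect_const (p : ι → ℝ) (c : ℝ) : expect p (fun _ => c) = c := by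
  have h := expect_const_mul p c fun _ => 1
  have h1 := expect_subset p ∅
  simp only [empty_subset, if_true, prod_empty] at h1
  simpa [h1] using h

lemma expect_mono {p : ι → ℝ} (h0 : ∀ i, 0 ≤ p i) (h1 : ∀ i, p i ≤ 1) {F G : Finset ι → ℝ}
    (h : ∀ ω, F ω ≤ G ω) : expect p F ≤ expect p G :=
  sum_le_sum fun ω _ => mul_le_mul_of_nonneg_left (h ω)
    (mul_nonneg (prod_nonneg fun i _ => h0 i) (prod_nonneg fun i _ => sub_nonneg.2 (h1 i)))

lemma exists_pos_of_expect_pos {p : ι → ℝ} (h0 : ∀ i, 0 ≤ p i) (h1 : ∀ i, p i ≤ 1)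
    {F : Finset ι → ℝ} (h : 0 < expect p F) : ∃ ω, 0 < F ω := by
  by_contra! hcon
  have := expect_mono h0 h1 hcon
  rw [expect_const] at this
  linarith

end Expectation

lemma joint_probability_le {p : α ⊕ β → ℝ} (h0 : ∀ i, 0 ≤ p i) (h1 : ∀ i, p i ≤ 1)
    {g : β → Finset α} {k R N : ℕ} (hN : 0 < N) {b b' : β} {a : α} (ha : a ∈ g b) (ha' : a ∈ g b')
    (hcard : #(g b) = R)
    (hp : ∀ a ∈ g b, 1 / (N : ℝ) ≤ p (Sum.inl a))
    (hσ : ∏ i ∈ (g b).disjSum {b}, p i = 1 / (N : ℝ) ^ R)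
    (hσ' : ∏ i ∈ (g b').disjSum {b'}, p i = 1 / (N : ℝ) ^ R) :
    ∏ i ∈ (g b).disjSum {b} ∪ (g b').disjSum {b'}, p i ≤
      1 / (N : ℝ) ^ R * (1 / (N : ℝ) ^ R / p (Sum.inl a) +
        (∑ c ∈ g b \ {a}, if c ∈ g b' then (N : ℝ) ^ (k - 1) / (N : ℝ) ^ R else 0) +
        (∑ T ∈ powersetCard k (g b), if T ⊆ g b' then 1 / (N : ℝ) else 0) +
        if g b ⊆ g b' then 1 else 0) := by
  have hN' : (0 : ℝ) < N := by exact_mod_cast hN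
  have hN1 : (1 : ℝ) ≤ N := by exact_mod_cast hN
  set σ : ℝ := 1 / (N : ℝ) ^ R with hσdef
  have hσ0 : 0 < σ := by positivity
  have hpa : 0 < p (Sum.inl a) := lt_of_lt_of_le (by positivity) (hp a ha)
  rw [← union_sdiff_self_eq_union, prod_union disjoint_sdiff, hσ]
  refine mul_le_mul_of_nonneg_left ?_ hσ0.le
  set Q := ∏ i ∈ (g b').disjSum {b'} \ (g b).disjSum {b}, p i with hQ
  have hQ1 : Q ≤ 1 := prod_le_one (fun i _ => h0 i) fun i _ => h1 i
  have hQ0 : 0 ≤ Q := prod_nonneg fun i _ => h0 i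
  have t1 : 0 ≤ σ / p (Sum.inl a) := by positivity
  have t2 : 0 ≤ ∑ c ∈ g b \ {a}, if c ∈ g b' then (N : ℝ) ^ (k - 1) / (N : ℝ) ^ R else 0 :=
    sum_nonneg fun c _ => by split_ifs <;> positivity
  have t3 : 0 ≤ ∑ T ∈ powersetCard k (g b), if T ⊆ g b' then 1 / (N : ℝ) else 0 :=
    sum_nonneg fun c _ => by split_ifs <;> positivity
  by_cases hsub : g b ⊆ g b'
  · rw [if_pos hsub]
    linarith
  rw [if_neg hsub, add_zero]
  have hbb : b ≠ b' := by
    rintro rfl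
    exact hsub Subset.rfl
  have hinter : (g b').disjSum {b'} ∩ (g b).disjSum {b} = (g b' ∩ g b).disjSum ∅ := by
    ext (x | x)
    · simp
    · simp only [mem_inter, inr_mem_disjSum, mem_singleton, notMem_empty, iff_false, not_and]
      rintro rfl h
      exact hbb h.symm
  have hmul : (∏ c ∈ g b' ∩ g b, p (Sum.inl c)) * Q = σ := by
    rw [← hσ', ← prod_inter_mul_prod_sdiff ((g b').disjSum {b'}) ((g b).disjSum {b}), hinter,
      prod_disjSum]
    simp [hQ]
  have hi : #(g b' ∩ g b) < R := by
    rw [← hcard]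
    refine card_lt_card ⟨inter_subset_right, fun h => hsub (h.trans inter_subset_left)⟩
  have hlow : (1 / (N : ℝ)) ^ #(g b' ∩ g b) ≤ ∏ c ∈ g b' ∩ g b, p (Sum.inl c) := by
    rw [← prod_const]
    exact prod_le_prod (fun _ _ => by positivity) fun c hc => hp c (mem_inter.1 hc).2
  have hQi : Q ≤ (N : ℝ) ^ #(g b' ∩ g b) / (N : ℝ) ^ R := by
    have h2 : (1 / (N : ℝ)) ^ #(g b' ∩ g b) * Q ≤ σ := by
      rw [← hmul]
      exact mul_le_mul_of_nonneg_right hlow hQ0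
    rw [one_div, inv_pow, inv_mul_le_iff₀ (by positivity)] at h2
    rw [hσdef, mul_one_div] at h2
    exact h2
  by_cases hex : ∃ c ∈ g b \ {a}, c ∈ g b'
  · by_cases hik : #(g b' ∩ g b) < k
    · obtain ⟨c, hc, hcb⟩ := hex
      have h3 : (N : ℝ) ^ #(g b' ∩ g b) / (N : ℝ) ^ R ≤ (N : ℝ) ^ (k - 1) / (N : ℝ) ^ R := by
        gcongr
        omega
      have h4 := single_le_sum (f := fun c => if c ∈ g b' then (N : ℝ) ^ (k - 1) / (N : ℝ) ^ R
        else 0) (fun c _ => by split_ifs <;> positivity) hc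
      simp only [hcb, if_true] at h4
      linarith
    · obtain ⟨T, hT, hTk⟩ := exists_subset_card_eq (not_lt.1 hik)
      have h3 : (N : ℝ) ^ #(g b' ∩ g b) / (N : ℝ) ^ R ≤ 1 / N := by
        rw [div_le_div_iff₀ (by positivity) hN', one_mul, ← pow_succ]
        exact pow_le_pow_right₀ hN1 hi
      have h4 := single_le_sum (f := fun T => if T ⊆ g b' then 1 / (N : ℝ) else 0)
        (fun c _ => by split_ifs <;> positivity)
        (mem_powersetCard.2 ⟨hT.trans inter_subset_right, hTk⟩)
      simp only [hT.trans inter_subset_left, if_true] at h4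
      linarith
  · have hsing : g b' ∩ g b = {a} := by
      ext c
      simp only [mem_inter, mem_singleton]
      constructor
      · rintro ⟨h, h'⟩
        by_contra hca
        exact hex ⟨c, by simp [h', hca], h⟩
      · rintro rfl
        exact ⟨ha', ha⟩
    rw [hsing, prod_singleton] at hmul
    have : Q = σ / p (Sum.inl a) := by
      rw [eq_div_iff hpa.ne', ← hmul, mul_comm]
    linarith

/-- Summing the joint probabilities over all pairs of right vertices adjacent to `a`. -/
lemma sum_joint_probability_le {p : α ⊕ β → ℝ} (h0 : ∀ i, 0 ≤ p i) (h1 : ∀ i, p i ≤ 1)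
    {B : Finset β} {g : β → Finset α} {k R N : ℕ} (hN : 0 < N) (hk : 0 < k) (hkR : k ≤ R)
    (hRN : R ≤ N) (hRN' : 2 ^ R * k ≤ N)
    (hcard : ∀ b ∈ B, #(g b) = R)
    (hp : ∀ b ∈ B, ∀ a ∈ g b, 1 / (N : ℝ) ≤ p (Sum.inl a))
    (hσ : ∀ b ∈ B, ∏ i ∈ (g b).disjSum {b}, p i = 1 / (N : ℝ) ^ R)
    (hcodeg : ∀ a a', a ≠ a' → #{b ∈ B | a ∈ g b ∧ a' ∈ g b} ≤ N ^ (R - k))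
    (hfree : ∀ T : Finset α, #T = k → #{b ∈ B | T ⊆ g b} ≤ k) (a : α)
    (hpa : (#{b ∈ B | a ∈ g b} : ℝ) = p (Sum.inl a) * (R * (N : ℝ) ^ R)) :
    ∑ b ∈ B with a ∈ g b, ∑ b' ∈ B with a ∈ g b',
      ∏ i ∈ (g b).disjSum {b} ∪ (g b').disjSum {b'}, p i ≤
      p (Sum.inl a) * R * (R + k + 2) := by
  have hN' : (0 : ℝ) < N := by exact_mod_cast hN
  set D : Finset β := {b ∈ B | a ∈ g b} with hD
  have hinner : ∀ b ∈ D, ∑ b' ∈ D, ∏ i ∈ (g b).disjSum {b} ∪ (g b').disjSum {b'}, p i ≤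
      1 / (N : ℝ) ^ R * (R + k + 2) := by
    intro b hb
    obtain ⟨hbB, hab⟩ := mem_filter.1 hb
    have hpa0 : 0 < p (Sum.inl a) := lt_of_lt_of_le (by positivity) (hp b hbB a hab)
    refine (sum_le_sum fun b' hb' => joint_probability_le (k := k) h0 h1 hN hab
      (mem_filter.1 hb').2 (hcard b hbB) (hp b hbB) (hσ b hbB)
      (hσ b' (mem_filter.1 hb').1)).trans ?_
    rw [← mul_sum]
    refine mul_le_mul_of_nonneg_left ?_ (by positivity)
    rw [sum_add_distrib, sum_add_distrib, sum_add_distrib]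
    have s1 : ∑ b' ∈ D, 1 / (N : ℝ) ^ R / p (Sum.inl a) = R := by
      rw [sum_const, nsmul_eq_mul, hpa]
      field_simp
    have s2 : ∑ b' ∈ D, ∑ c ∈ g b \ {a},
        (if c ∈ g b' then (N : ℝ) ^ (k - 1) / (N : ℝ) ^ R else 0) ≤ 1 := by
      rw [sum_comm]
      have : ∀ c ∈ g b \ {a}, ∑ b' ∈ D,
          (if c ∈ g b' then (N : ℝ) ^ (k - 1) / (N : ℝ) ^ R else 0) ≤ 1 / N := by
        intro c hc
        rw [← sum_filter, sum_const, nsmul_eq_mul, hD, filter_filter]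
        have hca : a ≠ c := by
          rintro rfl
          simp at hc
        have h2 : (#{b ∈ B | a ∈ g b ∧ c ∈ g b} : ℝ) ≤ (N : ℝ) ^ (R - k) := by
          exact_mod_cast hcodeg a c hca
        refine (mul_le_mul_of_nonneg_right h2 (by positivity)).trans ?_
        rw [← mul_div_assoc, ← pow_add, div_le_div_iff₀ (by positivity) hN', one_mul, ← pow_succ]
        exact le_of_eq (by congr 1; omega)
      refine (sum_le_card_nsmul _ _ _ this).trans ?_
      have h3 : (#(g b \ {a}) : ℝ) ≤ N := by
        have := card_le_card (sdiff_subset (s := g b) (t := {a}))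
        rw [hcard b hbB] at this
        exact_mod_cast this.trans hRN
      rw [nsmul_eq_mul, mul_one_div, div_le_one hN']
      exact h3
    have s3 : ∑ b' ∈ D, ∑ T ∈ powersetCard k (g b),
        (if T ⊆ g b' then 1 / (N : ℝ) else 0) ≤ 1 := by
      rw [sum_comm]
      have : ∀ T ∈ powersetCard k (g b), ∑ b' ∈ D,
          (if T ⊆ g b' then 1 / (N : ℝ) else 0) ≤ k * (1 / N) := by
        intro T hT
        rw [← sum_filter, sum_const, nsmul_eq_mul]
        refine mul_le_mul_of_nonneg_right ?_ (by positivity)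
        exact_mod_cast (card_le_card (filter_subset_filter _ (filter_subset _ _))).trans
          (hfree T (mem_powersetCard.1 hT).2)
      refine (sum_le_card_nsmul _ _ _ this).trans ?_
      rw [nsmul_eq_mul, card_powersetCard, hcard b hbB, ← mul_assoc, mul_one_div,
        div_le_one hN']
      exact_mod_cast (Nat.mul_le_mul_right k (Nat.choose_le_two_pow R k)).trans hRN'
    have s4 : ∑ b' ∈ D, (if g b ⊆ g b' then (1 : ℝ) else 0) ≤ k := by
      rw [← sum_filter, sum_const, nsmul_eq_mul, mul_one]
      obtain ⟨T, hT, hTk⟩ := exists_subset_card_eq (hkR.trans (hcard b hbB).ge)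
      have : #{b' ∈ D | g b ⊆ g b'} ≤ #{b ∈ B | T ⊆ g b} := by
        refine card_le_card fun b' hb' => ?_
        simp only [hD, mem_filter] at hb' ⊢
        exact ⟨hb'.1.1, hT.trans hb'.2⟩
      exact_mod_cast this.trans (hfree T hTk)
    linarith
  refine (sum_le_card_nsmul _ _ _ hinner).trans ?_
  rw [nsmul_eq_mul, hpa]
  apply le_of_eq
  field_simp

/-- A system of `R`-sets with small codegrees contains, by random sampling, a nearly
`R`-regular subsystem. -/
lemma exists_nearly_regular [Fintype α] [Fintype β] {B : Finset β} (hB : B.Nonempty)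
    {g : β → Finset α} {k R N h : ℕ} (hk : 0 < k)
    (hkR : k ≤ R) (hh : 0 < h) (hhR : (k + 2) * h ^ 2 ≤ R)
    (hRN : R ≤ N) (hRN' : 2 ^ R * k ≤ N)
    (hcard : ∀ b ∈ B, #(g b) = R)
    (hlow : ∀ b ∈ B, ∀ a ∈ g b, R * N ^ (R - 1) ≤ #{b ∈ B | a ∈ g b})
    (hhigh : ∀ a, #{b ∈ B | a ∈ g b} ≤ R * N ^ R)
    (hcodeg : ∀ a a', a ≠ a' → #{b ∈ B | a ∈ g b ∧ a' ∈ g b} ≤ N ^ (R - k))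
    (hfree : ∀ T : Finset α, #T = k → #{b ∈ B | T ⊆ g b} ≤ k) :
    ∃ A' : Finset α, ∃ B' ⊆ B, (∀ b ∈ B', g b ⊆ A') ∧
      (1 - 3 / (h : ℝ)) * (R / 2) * (#A' + #B') <
        ∑ a, (min #{b ∈ B' | a ∈ g b} R : ℝ) := by
  classical
  have hR : 0 < R := hk.trans_le hkR
  have hN : 0 < N := hR.trans_le hRN
  have hN' : (0 : ℝ) < N := by exact_mod_cast hN
  have hR' : (0 : ℝ) < R := by exact_mod_cast hR
  have hh' : (0 : ℝ) < h := by exact_mod_cast hh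
  set m : ℝ := R * (N : ℝ) ^ (R - 1) with hm
  have hm0 : 0 < m := by positivity
  have hmN : m * N = R * (N : ℝ) ^ R := by
    rw [hm, mul_assoc, ← pow_succ]
    congr 2
    omega
  let D : α → ℝ := fun a => #{b ∈ B | a ∈ g b}
  have hDm : ∀ b ∈ B, ∀ a ∈ g b, m ≤ D a := fun b hb a ha => by
    have := hlow b hb a ha
    simp only [D, hm]
    exact_mod_cast this
  have hDX : ∀ a, D a ≤ R * (N : ℝ) ^ R := fun a => by
    simp only [D]
    exact_mod_cast hhigh a
  have hD0 : ∀ a, 0 ≤ D a := fun a => by simp [D]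
  let p : α ⊕ β → ℝ := Sum.elim (fun a => D a / (R * (N : ℝ) ^ R))
    fun b => if b ∈ B then ∏ a ∈ g b, (m / D a) else 0
  have h0 : ∀ i, 0 ≤ p i := by
    rintro (a | b)
    · simp only [p, Sum.elim_inl]
      have := hD0 a
      positivity
    · simp only [p, Sum.elim_inr]
      split_ifs
      · exact prod_nonneg fun a _ => div_nonneg hm0.le (hD0 a)
      · exact le_rfl
  have h1 : ∀ i, p i ≤ 1 := by
    rintro (a | b)
    · simp only [p, Sum.elim_inl]
      exact div_le_one_of_le₀ (hDX a) (by positivity)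
    · simp only [p, Sum.elim_inr]
      split_ifs with hb
      · exact prod_le_one (fun a _ => div_nonneg hm0.le (hD0 a))
          fun a ha => div_le_one_of_le₀ (hDm b hb a ha) (hD0 a)
      · exact zero_le_one
  have hp : ∀ b ∈ B, ∀ a ∈ g b, 1 / (N : ℝ) ≤ p (Sum.inl a) := by
    intro b hb a ha
    simp only [p, Sum.elim_inl]
    rw [← hmN, div_le_div_iff₀ hN' (by positivity), one_mul]
    exact mul_le_mul_of_nonneg_right (hDm b hb a ha) hN'.le
  have hσ : ∀ b ∈ B, ∏ i ∈ (g b).disjSum {b}, p i = 1 / (N : ℝ) ^ R := by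
    intro b hb
    rw [prod_disjSum, prod_singleton]
    simp only [p, Sum.elim_inl, Sum.elim_inr, if_pos hb]
    have hconst : ∏ a ∈ g b, (1 / (N : ℝ)) = 1 / (N : ℝ) ^ R := by
      rw [prod_const, hcard b hb, one_div_pow]
    rw [← prod_mul_distrib, ← hconst]
    refine prod_congr rfl fun a ha => ?_
    have : 0 < D a := hm0.trans_le (hDm b hb a ha)
    rw [← hmN]
    field_simp
  have hpa : ∀ a, D a = p (Sum.inl a) * (R * (N : ℝ) ^ R) := by
    intro a
    simp only [p, Sum.elim_inl]
    field_simp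
  let I : β → Finset (α ⊕ β) → ℝ := fun b ω => if (g b).disjSum {b} ⊆ ω then 1 else 0
  let J : α → Finset (α ⊕ β) → ℝ := fun a ω => if {Sum.inl a} ⊆ ω then 1 else 0
  let P : β → β → Finset (α ⊕ β) → ℝ := fun b b' ω =>
    if (g b).disjSum {b} ∪ (g b').disjSum {b'} ⊆ ω then 1 else 0
  let c : ℝ := (1 - 3 / (h : ℝ)) * (R / 2)
  let F : Finset (α ⊕ β) → ℝ := fun ω =>
    (∑ a, ((1 + h / 2) * (∑ b ∈ B with a ∈ g b, I b ω) - ((R / h + h * R / 4) * J a ω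
      + (h / (4 * R)) * ∑ b ∈ B with a ∈ g b, ∑ b' ∈ B with a ∈ g b', P b b' ω)))
    - (c * ∑ a, J a ω + c * ∑ b ∈ B, I b ω)
  have hEI : ∀ b ∈ B, expect p (I b) = 1 / (N : ℝ) ^ R := fun b hb => by
    rw [← hσ b hb]
    exact expect_subset p _
  have hEJ : ∀ a, expect p (J a) = p (Sum.inl a) := fun a => by
    have := expect_subset p {Sum.inl a}
    rwa [prod_singleton] at this
  have hEF : 0 < expect p F := by
    have hsumD : ∑ a, D a = R * #B := by
      simp only [D, card_filter, Nat.cast_sum]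
      rw [sum_comm]
      have : ∀ b ∈ B, ∑ a, (((if a ∈ g b then 1 else 0 : ℕ)) : ℝ) = R := by
        intro b hb
        rw [← hcard b hb]
        simp
      rw [sum_congr rfl this, sum_const, nsmul_eq_mul, mul_comm]
    have hsump : ∑ a, p (Sum.inl a) = #B / (N : ℝ) ^ R := by
      have : ∀ a, p (Sum.inl a) = D a / (R * (N : ℝ) ^ R) := fun a => rfl
      simp only [this]
      rw [← sum_div, hsumD, mul_div_mul_left _ _ hR'.ne']
    have hper : ∀ a, p (Sum.inl a) * (R * (1 - 5 / (4 * h))) ≤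
        (1 + h / 2) * (∑ b ∈ B with a ∈ g b, 1 / (N : ℝ) ^ R) -
          ((R / h + h * R / 4) * p (Sum.inl a)
          + (h / (4 * R)) * ∑ b ∈ B with a ∈ g b, ∑ b' ∈ B with a ∈ g b',
            ∏ i ∈ (g b).disjSum {b} ∪ (g b').disjSum {b'}, p i) := by
      intro a
      have h2 := sum_joint_probability_le h0 h1 hN hk hkR hRN hRN' hcard hp hσ hcodeg hfree a
        (hpa a)
      have h3 : ∑ b ∈ B with a ∈ g b, 1 / (N : ℝ) ^ R = p (Sum.inl a) * R := by
        rw [sum_const, nsmul_eq_mul]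
        change D a * _ = _
        rw [hpa a]
        field_simp
      rw [h3]
      have h4 : (h / (4 * R) : ℝ) * ∑ b ∈ B with a ∈ g b, ∑ b' ∈ B with a ∈ g b',
            ∏ i ∈ (g b).disjSum {b} ∪ (g b').disjSum {b'}, p i ≤
          (h / (4 * R) : ℝ) * (p (Sum.inl a) * R * (R + k + 2)) :=
        mul_le_mul_of_nonneg_left h2 (by positivity)
      have h5 : (h / (4 * R) : ℝ) * (p (Sum.inl a) * R * (R + k + 2)) =
          p (Sum.inl a) * (h / 4 * R + h / 4 * (k + 2)) := by
        field_simp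
        ring
      have h6 : (h : ℝ) / 4 * (k + 2) ≤ R / (4 * h) := by
        rw [le_div_iff₀ (by positivity)]
        have : ((k : ℝ) + 2) * h ^ 2 ≤ R := by exact_mod_cast hhR
        nlinarith
      have h7 : p (Sum.inl a) * (h / 4 * (k + 2)) ≤ p (Sum.inl a) * (R / (4 * h)) :=
        mul_le_mul_of_nonneg_left h6 (h0 _)
      have h8 : p (Sum.inl a) * (R * (1 - 5 / (4 * h))) = p (Sum.inl a) * R -
          p (Sum.inl a) * (R / (4 * h)) - R / h * p (Sum.inl a) := by
        field_simp
        ring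
      rw [h8]
      linarith
    have hexp : expect p F = (∑ a, ((1 + h / 2) * (∑ b ∈ B with a ∈ g b, 1 / (N : ℝ) ^ R) -
          ((R / h + h * R / 4) * p (Sum.inl a)
          + (h / (4 * R)) * ∑ b ∈ B with a ∈ g b, ∑ b' ∈ B with a ∈ g b',
            ∏ i ∈ (g b).disjSum {b} ∪ (g b').disjSum {b'}, p i))) -
          (c * ∑ a, p (Sum.inl a) + c * ∑ b ∈ B, 1 / (N : ℝ) ^ R) := by
      have hP : ∀ b b', expect p (P b b') =
          ∏ i ∈ (g b).disjSum {b} ∪ (g b').disjSum {b'}, p i := fun b b' => expect_subset p _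
      have hI' : ∀ a, ∑ b ∈ B with a ∈ g b, expect p (I b) =
          ∑ b ∈ B with a ∈ g b, 1 / (N : ℝ) ^ R := fun a =>
        sum_congr rfl fun b hb => hEI b (mem_filter.1 hb).1
      have hI'' : ∑ b ∈ B, expect p (I b) = ∑ b ∈ B, 1 / (N : ℝ) ^ R :=
        sum_congr rfl fun b hb => hEI b hb
      simp only [F, expect_add, expect_sub, expect_const_mul, expect_sum, hP, hEJ, hI', hI'']
    rw [hexp]
    have h2 := sum_le_sum fun a (_ : a ∈ (univ : Finset α)) => hper a
    rw [← sum_mul, hsump] at h2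
    rw [hsump, sum_const, nsmul_eq_mul]
    have hBpos : 0 < (#B : ℝ) / (N : ℝ) ^ R := by
      have : 0 < (#B : ℝ) := by exact_mod_cast hB.card_pos
      exact div_pos this (pow_pos hN' R)
    have h9 : c * ((#B : ℝ) / (N : ℝ) ^ R) + c * (#B * (1 / (N : ℝ) ^ R)) =
        (#B : ℝ) / (N : ℝ) ^ R * (R * (1 - 3 / h)) := by
      simp only [c]
      ring
    rw [h9]
    have h10 : (R : ℝ) * (1 - 3 / h) < R * (1 - 5 / (4 * h)) := by
      refine mul_lt_mul_of_pos_left ?_ hR'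
      have : (5 : ℝ) / (4 * h) < 3 / h := by
        rw [div_lt_div_iff₀ (by positivity) hh']
        nlinarith
      linarith
    have := mul_lt_mul_of_pos_left h10 hBpos
    linarith
  obtain ⟨ω, hω⟩ := exists_pos_of_expect_pos h0 h1 hEF
  refine ⟨({a | {Sum.inl a} ⊆ ω} : Finset α), {b ∈ B | (g b).disjSum {b} ⊆ ω},
    filter_subset _ _, ?_, ?_⟩
  · intro b hb a ha
    simp only [mem_filter, mem_univ, true_and, singleton_subset_iff]
    exact (mem_filter.1 hb).2 (by simpa using ha)
  · have hJ : ∑ a, J a ω = (#({a | {Sum.inl a} ⊆ ω} : Finset α) : ℝ) := by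
      simp [J]
    have hI : ∑ b ∈ B, I b ω = (#{b ∈ B | (g b).disjSum {b} ⊆ ω} : ℝ) := by
      simp [I]
    have hmain : ∀ a, (1 + h / 2) * (∑ b ∈ B with a ∈ g b, I b ω) - ((R / h + h * R / 4) * J a ω
        + (h / (4 * R)) * ∑ b ∈ B with a ∈ g b, ∑ b' ∈ B with a ∈ g b', P b b' ω) ≤
        (min #{b ∈ {b ∈ B | (g b).disjSum {b} ⊆ ω} | a ∈ g b} R : ℝ) := by
      intro a
      have hPI : ∀ b b', P b b' ω = I b ω * I b' ω := by
        intro b b'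
        simp only [P, I, union_subset_iff]
        by_cases h2 : (g b).disjSum {b} ⊆ ω <;> by_cases h3 : (g b').disjSum {b'} ⊆ ω <;>
          simp [h2, h3]
      have hNa : ∑ b ∈ B with a ∈ g b, I b ω =
          (#{b ∈ {b ∈ B | (g b).disjSum {b} ⊆ ω} | a ∈ g b} : ℝ) := by
        simp only [I]
        rw [filter_comm, ← sum_filter]
        simp
      simp only [hPI, ← sum_mul_sum]
      rw [hNa]
      by_cases ha : Sum.inl a ∈ ω
      · have hJ1 : J a ω = 1 := by simp [J, ha]
        rw [hJ1]
        set n : ℝ := (#{b ∈ {b ∈ B | (g b).disjSum {b} ⊆ ω} | a ∈ g b} : ℝ)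
        have key : ∀ x : ℝ, x ≤ R / h + h / (4 * R) * x ^ 2 := by
          intro x
          have : 0 ≤ h / (4 * R) * (x - 2 * R / h) ^ 2 := by positivity
          have h2 : h / (4 * R) * (x - 2 * R / h) ^ 2 =
            h / (4 * R) * x ^ 2 - x + R / h := by
            field_simp
            ring
          linarith
        have h3 : h / (4 * R) * (n - R) ^ 2 = h / (4 * R) * (n * n) - h / 2 * n + h * R / 4 := by
          field_simp
          ring
        have h4 := key (n - R)
        have h5 := key 0
        have h6 : 0 ≤ h / (4 * R) * (n - R) ^ 2 := by positivity
        refine le_min ?_ ?_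
        · have : 0 ≤ (R / h : ℝ) := by positivity
          linarith
        · linarith
      · have hJ0 : J a ω = 0 := by simp [J, ha]
        have hn : #{b ∈ {b ∈ B | (g b).disjSum {b} ⊆ ω} | a ∈ g b} = 0 := by
          rw [card_eq_zero, filter_eq_empty_iff]
          intro b hb hab
          exact ha ((mem_filter.1 hb).2 (by simpa using hab))
        rw [hJ0, hn]
        simp
    have h2 := sum_le_sum fun a (_ : a ∈ (univ : Finset α)) => hmain a
    simp only [F, hJ, hI] at hω
    simp only [c] at hω
    linarith

/-- A system of `R`-sets in which degrees are neither too small nor too large and codegrees are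
small contains a `k`-regular bipartite graph. -/
lemma exists_isBiregular_of_degrees [Fintype α] [Fintype β] {B : Finset β} (hB : B.Nonempty)
    {g : β → Finset α} {k q R N : ℕ} (hq : q.Prime) (hk : 0 < k) (hkq : k ≤ q)
    (hqR : (k + 2) * (6 * (2 * q - 1)) ^ 2 ≤ R)
    (hRN : R ≤ N) (hRN' : 2 ^ R * k ≤ N)
    (hcard : ∀ b ∈ B, #(g b) = R)
    (hlow : ∀ b ∈ B, ∀ a ∈ g b, R * N ^ (R - 1) ≤ #{b ∈ B | a ∈ g b})
    (hhigh : ∀ a, #{b ∈ B | a ∈ g b} ≤ R * N ^ R)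
    (hcodeg : ∀ a a', a ≠ a' → #{b ∈ B | a ∈ g b ∧ a' ∈ g b} ≤ N ^ (R - k))
    (hfree : ∀ T : Finset α, #T = k → #{b ∈ B | T ⊆ g b} ≤ k) :
    ∃ F : Finset (α × β), IsBiregular F k ∧ ∀ e ∈ F, e.2 ∈ B ∧ e.1 ∈ g e.2 := by
  obtain ⟨s, hs⟩ : ∃ s, 2 * q - 1 = s := ⟨_, rfl⟩
  have hs0 : 0 < s := by have := hq.two_le; omega
  rw [hs] at hqR
  have hkR : k ≤ R := by nlinarith [Nat.one_le_pow 2 (6 * s) (by omega)]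
  obtain ⟨A', B', hB'B, hA', hsum⟩ := exists_nearly_regular hB (h := 6 * s) hk hkR (by omega) hqR
    hRN hRN' hcard hlow hhigh hcodeg hfree
  choose S hS hSc using fun a => exists_subset_card_eq (Nat.min_le_left #{b ∈ B' | a ∈ g b} R)
  let E : Finset (α × β) := {e | e.2 ∈ S e.1}
  have hE : ∀ e ∈ E, e.2 ∈ B' ∧ e.1 ∈ g e.2 := fun e he =>
    mem_filter.1 (hS e.1 (mem_filter.1 he).2)
  have hleft : ∀ a, leftDeg E a = #(S a) := by
    intro a
    refine card_nbij' (fun e => e.2) (fun b => (a, b)) ?_ ?_ ?_ ?_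
    · intro e he
      simp only [E, coe_filter, mem_filter, mem_univ, true_and, Set.mem_ofPred_eq] at he
      rw [← he.2]
      exact he.1
    · intro b hb
      simpa [E] using hb
    · rintro ⟨a', b⟩ he
      simp only [coe_filter, Set.mem_ofPred_eq] at he
      simp [he.2]
    · intro b _
      rfl
  have hright : ∀ b, rightDeg E b ≤ R := by
    intro b
    by_cases hb : b ∈ B'
    · rw [← hcard b (hB'B hb)]
      refine card_le_card_of_injOn (fun e => e.1) ?_ ?_
      · intro e he
        obtain ⟨heE, rfl⟩ := mem_filter.1 (mem_coe.1 he)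
        exact (hE e heE).2
      · rintro ⟨a, b₁⟩ h₁ ⟨a', b₂⟩ h₂ haa
        simp only [coe_filter, Set.mem_ofPred_eq] at h₁ h₂ haa
        rw [haa, h₁.2, h₂.2]
    · have : rightDeg E b = 0 := by
        rw [rightDeg, card_eq_zero, filter_eq_empty_iff]
        rintro e he rfl
        exact hb (hE e he).1
      omega
  obtain ⟨F, hF, hFk⟩ := exists_isBiregular_of_nearly_regular hq hk hkq (R := R) (E := E) (A := A')
    (B := B') (by rw [hs]; nlinarith) (fun e he => hA' _ (hE e he).1 (hE e he).2)
    (fun e he => (hE e he).1)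
    (fun a => by rw [hleft, hSc]; exact Nat.min_le_right _ _) hright (by
      have hEc : (#E : ℝ) = ∑ a, (min #{b ∈ B' | a ∈ g b} R : ℝ) := by
        rw [← sum_leftDeg (A := univ) fun e _ => mem_univ _, Nat.cast_sum]
        exact sum_congr rfl fun a _ => by rw [hleft, hSc, Nat.cast_min]
      rw [← hEc] at hsum
      rw [hs]
      have hs' : (0 : ℝ) < s := by exact_mod_cast hs0
      have h1 : (1 - 3 / ((6 * s : ℕ) : ℝ)) * (R / 2) * (#A' + #B') =
          ((2 * s - 1) * R * (#A' + #B')) / (4 * s) := by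
        push_cast
        field_simp
        ring
      rw [h1, div_lt_iff₀ (by positivity)] at hsum
      have h2 : ((2 * s - 1 : ℕ) : ℝ) = 2 * s - 1 := by
        rw [Nat.cast_sub (by omega)]
        simp
      rify
      rw [h2]
      linarith)
  exact ⟨F, hFk, fun e he => ⟨hB'B (hE e (hF he)).1, (hE e (hF he)).2⟩⟩

/-- Passing to a subsystem of `R`-sets with large minimum degree. -/
lemma exists_large_min_degree {α β : Type*} [DecidableEq α] [Fintype α] {B : Finset β}
    {g : β → Finset α} {A : Finset α} {m : ℕ}
    (hg : ∀ b ∈ B, g b ⊆ A) (hm : m * #A < #B) :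
    ∃ B₁ ⊆ B, B₁.Nonempty ∧ ∀ b ∈ B₁, ∀ a ∈ g b, m ≤ #{b ∈ B₁ | a ∈ g b} := by
  obtain ⟨A₁, -, hmax⟩ := exists_max_image univ
    (fun A₁ : Finset α => (#{b ∈ B | g b ⊆ A₁} : ℤ) - m * #A₁) ⟨A, mem_univ A⟩
  refine ⟨{b ∈ B | g b ⊆ A₁}, filter_subset _ _, ?_, ?_⟩
  · have h1 := hmax A (mem_univ A)
    rw [filter_true_of_mem hg] at h1
    rw [← card_pos]
    zify at hm ⊢
    have : 0 ≤ (m : ℤ) * #A₁ := by positivity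
    linarith
  · intro b hb a ha
    have haA := (mem_filter.1 hb).2 ha
    have h1 := hmax (A₁.erase a) (mem_univ _)
    rw [cast_card_erase_of_mem haA] at h1
    have h2 : #{b ∈ B | g b ⊆ A₁} ≤
        #{b ∈ B | g b ⊆ A₁.erase a} + #{b ∈ {b ∈ B | g b ⊆ A₁} | a ∈ g b} := by
      rw [← card_filter_add_card_filter_not (s := {b ∈ B | g b ⊆ A₁}) fun b => a ∈ g b, add_comm]
      refine Nat.add_le_add_right (card_le_card fun b hb => ?_) _
      simp only [mem_filter] at hb ⊢
      exact ⟨hb.1.1, subset_erase.2 ⟨hb.1.2, hb.2⟩⟩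
    zify at h2 ⊢
    linarith

/-- A system of `R`-sets with large average degree, bounded maximum degree and small codegrees
contains a `k`-regular bipartite graph. -/
lemma exists_isBiregular_of_codegree [Fintype α] [Fintype β] {B : Finset β}
    {g : β → Finset α} {A : Finset α} {k q R N : ℕ} (hq : q.Prime) (hk : 0 < k) (hkq : k ≤ q)
    (hqR : (k + 2) * (6 * (2 * q - 1)) ^ 2 ≤ R)
    (hRN : R ≤ N) (hRN' : 2 ^ R * k ≤ N)
    (hcard : ∀ b ∈ B, #(g b) = R) (hg : ∀ b ∈ B, g b ⊆ A)
    (hBA : R * N ^ (R - 1) * #A < #B)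
    (hhigh : ∀ a, #{b ∈ B | a ∈ g b} ≤ R * N ^ R)
    (hcodeg : ∀ a a', a ≠ a' → #{b ∈ B | a ∈ g b ∧ a' ∈ g b} ≤ N ^ (R - k))
    (hfree : ∀ T : Finset α, #T = k → #{b ∈ B | T ⊆ g b} ≤ k) :
    ∃ F : Finset (α × β), IsBiregular F k ∧ ∀ e ∈ F, e.2 ∈ B ∧ e.1 ∈ g e.2 := by
  obtain ⟨B₁, hB₁, hne, hlow⟩ := exists_large_min_degree hg hBA
  obtain ⟨F, hF, h⟩ := exists_isBiregular_of_degrees hne hq hk hkq hqR hRN hRN'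
    (fun b hb => hcard b (hB₁ hb)) hlow
    (fun a => (card_le_card (filter_subset_filter _ hB₁)).trans (hhigh a))
    (fun a a' haa => (card_le_card (filter_subset_filter _ hB₁)).trans (hcodeg a a' haa))
    (fun T hT => (card_le_card (filter_subset_filter _ hB₁)).trans (hfree T hT))
  exact ⟨F, hF, fun e he => ⟨hB₁ (h e he).1, (h e he).2⟩⟩

/-- Greedy choice of an independent set for a relation of small degree. -/
lemma exists_independent_subset {r : α → α → Prop} [DecidableRel r] (hr : ∀ x y, r x y → r y x)
    {k : ℕ} (hk : 0 < k) (R : ℕ) : ∀ {X : Finset α}, (∀ x ∈ X, #{y ∈ X | r x y} < k) → k * R ≤ #X →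
      ∃ Y ⊆ X, #Y = R ∧ ∀ x ∈ Y, ∀ y ∈ Y, x ≠ y → ¬ r x y := by
  induction R with
  | zero => exact fun _ _ => ⟨∅, empty_subset _, by simp⟩
  | succ R ih =>
    intro X hX hc
    obtain rfl | ⟨x, hx⟩ := X.eq_empty_or_nonempty
    · have : 0 < k * (R + 1) := by positivity
      simp only [card_empty] at hc
      omega
    · let Z := insert x {y ∈ X | r x y}
      have hZ : #Z ≤ k := (card_insert_le _ _).trans (hX x hx)
      have hZX : #X - #Z ≤ #(X \ Z) := le_card_sdiff _ _
      obtain ⟨Y, hY, hYc, hYr⟩ := ih (X := X \ Z)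
        (fun y hy => (card_le_card (filter_subset_filter _ sdiff_subset)).trans_lt
          (hX y (mem_sdiff.1 hy).1)) (by rw [mul_add, mul_one] at hc; omega)
      have hxr : ∀ y ∈ Y, ¬ r x y := fun y hy hxy =>
        (mem_sdiff.1 (hY hy)).2 (mem_insert_of_mem (mem_filter.2 ⟨(mem_sdiff.1 (hY hy)).1, hxy⟩))
      have hxY : x ∉ Y := fun h => (mem_sdiff.1 (hY h)).2 (mem_insert_self _ _)
      refine ⟨insert x Y, insert_subset hx (hY.trans sdiff_subset), ?_, ?_⟩
      · rw [card_insert_of_notMem hxY, hYc]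
      · intro y hy z hz hyz
        rw [mem_insert] at hy hz
        rcases hy with rfl | hy <;> rcases hz with rfl | hz
        · exact absurd rfl hyz
        · exact hxr z hz
        · exact fun h => hxr y hy (hr _ _ h)
        · exact hYr y hy z hz hyz

/-- A vertex of bounded degree has few partners of large codegree. -/
lemma card_large_codegree_le {α β : Type*} [DecidableEq α] [Fintype α] {S : Finset β}
    {F : β → Finset α} {t D c : ℕ} (hF : ∀ b ∈ S, #(F b) ≤ t) (a : α) (ha : #{b ∈ S | a ∈ F b} ≤ D) :
    #{a' | c < #{b ∈ S | a ∈ F b ∧ a' ∈ F b}} * c ≤ t * D := by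
  calc #{a' | c < #{b ∈ S | a ∈ F b ∧ a' ∈ F b}} * c
      ≤ ∑ a' with c < #{b ∈ S | a ∈ F b ∧ a' ∈ F b}, #{b ∈ S | a ∈ F b ∧ a' ∈ F b} := by
        rw [← smul_eq_mul]
        exact card_nsmul_le_sum _ _ _ fun a' h => (mem_filter.1 h).2.le
    _ ≤ ∑ a', #{b ∈ S | a ∈ F b ∧ a' ∈ F b} := sum_le_sum_of_subset (subset_univ _)
    _ = ∑ b ∈ S with a ∈ F b, #(F b) := by
        simp only [← filter_filter]
        have := sum_card_bipartiteAbove_eq_sum_card_bipartiteBelow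
          (s := (univ : Finset α)) (t := {b ∈ S | a ∈ F b}) fun a' b => a' ∈ F b
        simp only [bipartiteAbove, bipartiteBelow] at this
        rw [this]
        exact sum_congr rfl fun b _ => by simp
    _ ≤ #{b ∈ S | a ∈ F b} * t := by
        rw [← smul_eq_mul]
        exact sum_le_card_nsmul _ _ _ fun b hb => hF b (mem_filter.1 hb).1
    _ ≤ t * D := by
        rw [mul_comm]
        exact Nat.mul_le_mul_left _ ha

/-- A system of sets of bounded degree and large average degree in which no `k`-set is contained
in more than `k` members contains a `k`-regular bipartite graph. -/
lemma exists_isBiregular_of_bounded_degree [Fintype α] [Fintype β] {S : Finset β}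
    {F : β → Finset α} {A : Finset α} {k q R N : ℕ} (hq : q.Prime) (hk : 0 < k) (hkq : k ≤ q)
    (hqR : (k + 2) * (6 * (2 * q - 1)) ^ 2 ≤ R)
    (hRN : R ≤ N) (hRN' : 2 ^ R * k ≤ N) (hN : (k * R ^ 2) ^ k * k ≤ N)
    (hcard : ∀ b ∈ S, #(F b) = k * R) (hF : ∀ b ∈ S, F b ⊆ A)
    (hSA : (R + 1) * N ^ (R - 1) * #A < #S)
    (hhigh : ∀ a, #{b ∈ S | a ∈ F b} ≤ R * N ^ R)
    (hfree : ∀ T : Finset α, #T = k → #{b ∈ S | T ⊆ F b} ≤ k) :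
    ∃ E : Finset (α × β), IsBiregular E k ∧ ∀ e ∈ E, e.2 ∈ S ∧ e.1 ∈ F e.2 := by
  classical
  have hkR : k ^ 2 + 2 ≤ R := by
    have h1 : k ≤ 2 * q - 1 := by omega
    have h2 : k ^ 2 ≤ (2 * q - 1) ^ 2 := Nat.pow_le_pow_left h1 2
    have h3 : 1 ≤ (2 * q - 1) ^ 2 := Nat.one_le_pow _ _ (by omega)
    nlinarith
  have hkR' : k ≤ R := by nlinarith
  have hR : 0 < R := hk.trans_le hkR'
  have hN0 : 0 < N := hR.trans_le hRN
  let bad : α → Finset α := fun a => {a' | N ^ (R - k) < #{b ∈ S | a ∈ F b ∧ a' ∈ F b}}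
  have hbad : ∀ a, #(bad a) ≤ k * R ^ 2 * N ^ k := by
    intro a
    have h1 := card_large_codegree_le (c := N ^ (R - k)) (fun b hb => (hcard b hb).le) a (hhigh a)
    have h2 : k * R * (R * N ^ R) = k * R ^ 2 * N ^ k * N ^ (R - k) := by
      have : N ^ R = N ^ k * N ^ (R - k) := by
        rw [← pow_add]
        congr 1
        omega
      rw [this]
      ring
    rw [h2] at h1
    exact Nat.le_of_mul_le_mul_right h1 (by positivity)
  let spoiled : α → Finset β := fun a => {b ∈ S | a ∈ F b ∧ k ≤ #{a' ∈ F b | a' ∈ bad a}}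
  have hspoiled : ∀ a, #(spoiled a) ≤ N ^ (R - 1) := by
    intro a
    have h1 : spoiled a ⊆ (powersetCard k (bad a)).biUnion fun T => {b ∈ S | T ⊆ F b} := by
      intro b hb
      simp only [spoiled, mem_filter] at hb
      obtain ⟨T, hT, hTk⟩ := exists_subset_card_eq hb.2.2
      refine mem_biUnion.2 ⟨T, mem_powersetCard.2 ⟨fun x hx => (mem_filter.1 (hT hx)).2, hTk⟩,
        mem_filter.2 ⟨hb.1, fun x hx => (mem_filter.1 (hT hx)).1⟩⟩
    calc #(spoiled a) ≤ #(powersetCard k (bad a)) * k := (card_le_card h1).trans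
          (card_biUnion_le_card_mul _ _ _ fun T hT => hfree T (mem_powersetCard.1 hT).2)
      _ ≤ #(bad a) ^ k * k := by
          rw [card_powersetCard]
          exact Nat.mul_le_mul_right _ (Nat.choose_le_pow _ _)
      _ ≤ (k * R ^ 2 * N ^ k) ^ k * k :=
          Nat.mul_le_mul_right _ (Nat.pow_le_pow_left (hbad a) k)
      _ = ((k * R ^ 2) ^ k * k) * N ^ (k ^ 2) := by
          rw [mul_pow, ← pow_mul, ← sq]
          ring
      _ ≤ N * N ^ (k ^ 2) := Nat.mul_le_mul_right _ hN
      _ = N ^ (k ^ 2 + 1) := by ring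
      _ ≤ N ^ (R - 1) := Nat.pow_le_pow_right hN0 (by omega)
  let B := S \ A.biUnion spoiled
  have hBS : B ⊆ S := sdiff_subset
  have hBc : R * N ^ (R - 1) * #A < #B := by
    have h1 : #(A.biUnion spoiled) ≤ #A * N ^ (R - 1) :=
      card_biUnion_le_card_mul _ _ _ fun a _ => hspoiled a
    have h2 : #S - #(A.biUnion spoiled) ≤ #B := le_card_sdiff _ _
    have h3 : (R + 1) * N ^ (R - 1) * #A = R * N ^ (R - 1) * #A + #A * N ^ (R - 1) := by ring
    omega
  have hind : ∀ b ∈ B, ∃ Y ⊆ F b, #Y = R ∧ ∀ x ∈ Y, ∀ y ∈ Y, x ≠ y → y ∉ bad x := by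
    intro b hb
    obtain ⟨hbS, hbsp⟩ := mem_sdiff.1 hb
    refine exists_independent_subset (r := fun x y => y ∈ bad x) ?_ hk R ?_
      (hcard b hbS).ge
    · intro x y hxy
      simpa [bad, and_comm] using hxy
    · intro x hx
      by_contra! hcon
      exact hbsp (mem_biUnion.2 ⟨x, hF b hbS hx, mem_filter.2 ⟨hbS, hx, hcon⟩⟩)
  choose! g hgF hgR hgbad using hind
  obtain ⟨E, hE, h⟩ := exists_isBiregular_of_codegree (B := B) (g := g) (A := A) hq hk hkq hqR hRN
    hRN' hgR (fun b hb => (hgF b hb).trans (hF b (hBS hb))) hBc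
    (fun a => (card_le_card fun b hb => by
      simp only [mem_filter] at hb ⊢
      exact ⟨hBS hb.1, hgF b hb.1 hb.2⟩).trans (hhigh a))
    (fun a a' haa => by
      obtain h0 | ⟨b, hb⟩ := ({b ∈ B | a ∈ g b ∧ a' ∈ g b}).eq_empty_or_nonempty
      · rw [h0]
        simp
      · obtain ⟨hbB, hab, hab'⟩ := mem_filter.1 hb
        have := hgbad b hbB a hab a' hab' haa
        simp only [bad, mem_filter, mem_univ, true_and, not_lt] at this
        refine (card_le_card fun b hb => ?_).trans this
        simp only [mem_filter] at hb ⊢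
        exact ⟨hBS hb.1, hgF b hb.1 hb.2.1, hgF b hb.1 hb.2.2⟩)
    (fun T hT => (card_le_card fun b hb => by
      simp only [mem_filter] at hb ⊢
      exact ⟨hBS hb.1, hb.2.trans (hgF b hb.1)⟩).trans (hfree T hT))
  exact ⟨E, hE, fun e he => ⟨hBS (h e he).1, hgF _ (h e he).1 (h e he).2⟩⟩

/-- Hall's theorem with capacities: either every member of the system can be assigned one of its
elements, with every element being used at most `M` times, or there is an obstruction. -/
lemma exists_assignment_or_obstruction {S : Finset β} (hS : S.Nonempty) (H : β → Finset α) (M : ℕ) :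
    (∃ f : β → α, (∀ b ∈ S, f b ∈ H b) ∧ ∀ a, #{b ∈ S | f b = a} ≤ M) ∨
      ∃ S' ⊆ S, M * #(S'.biUnion H) < #S' := by
  classical
  obtain ⟨b₀, hb₀⟩ := hS
  let t : S → Finset (α × ℕ) := fun b => H b ×ˢ range M
  by_cases h : ∀ s : Finset S, #s ≤ #(s.biUnion t)
  · left
    obtain ⟨f, hf, hft⟩ := (all_card_le_biUnion_card_iff_exists_injective t).1 h
    refine ⟨fun b => if hb : b ∈ S then (f ⟨b, hb⟩).1 else (f ⟨b₀, hb₀⟩).1, ?_, ?_⟩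
    · intro b hb
      simp only [dif_pos hb]
      exact (mem_product.1 (hft ⟨b, hb⟩)).1
    · intro a
      rw [← card_range M]
      refine card_le_card_of_injOn
        (fun b => if hb : b ∈ S then (f ⟨b, hb⟩).2 else 0) ?_ ?_
      · intro b hb
        have hbS := (mem_filter.1 (mem_coe.1 hb)).1
        simp only [dif_pos hbS]
        exact (mem_product.1 (hft ⟨b, hbS⟩)).2
      · intro b hb b' hb' hbb
        obtain ⟨hbS, h1⟩ := mem_filter.1 (mem_coe.1 hb)
        obtain ⟨hbS', h2⟩ := mem_filter.1 (mem_coe.1 hb')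
        simp only [dif_pos hbS, dif_pos hbS'] at h1 h2 hbb
        have := hf (Prod.ext (h1.trans h2.symm) hbb)
        simpa using this
  · right
    push Not at h
    obtain ⟨s, hs⟩ := h
    refine ⟨s.map (Function.Embedding.subtype _), fun b hb => ?_, ?_⟩
    · obtain ⟨x, -, rfl⟩ := mem_map.1 hb
      exact x.2
    · rw [card_map]
      refine lt_of_eq_of_lt ?_ hs
      rw [mul_comm, ← card_range M, ← card_product]
      congr 1
      ext ⟨a, i⟩
      simp only [t, mem_product, mem_biUnion, mem_map]
      constructor
      · rintro ⟨⟨_, ⟨x, hx, rfl⟩, ha⟩, hi⟩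
        exact ⟨x, hx, ha, hi⟩
      · rintro ⟨x, hx, ha, hi⟩
        exact ⟨⟨x, ⟨x, hx, rfl⟩, ha⟩, hi⟩

/-- Iterating Hall's theorem with capacities `r` times. -/
lemma exists_bounded_system_or_obstruction {S : Finset β} (hS : S.Nonempty) (H : β → Finset α)
    (M r : ℕ) :
    (∃ F : β → Finset α, (∀ b ∈ S, F b ⊆ H b ∧ #(F b) = r) ∧
      ∀ a, #{b ∈ S | a ∈ F b} ≤ r * M) ∨
    ∃ H' : β → Finset α, (∀ b, H' b ⊆ H b ∧ #(H b) ≤ #(H' b) + r) ∧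
      ∃ S' ⊆ S, M * #(S'.biUnion H') < #S' := by
  induction r with
  | zero => exact Or.inl ⟨fun _ => ∅, by simp⟩
  | succ r ih =>
    obtain ⟨F, hF, hFM⟩ | ⟨H', hH', h⟩ := ih
    · obtain ⟨f, hf, hfM⟩ | ⟨S', hS', h⟩ :=
        exists_assignment_or_obstruction hS (fun b => H b \ F b) M
      · refine Or.inl ⟨fun b => insert (f b) (F b), fun b hb => ?_, fun a => ?_⟩
        · obtain ⟨h1, h2⟩ := mem_sdiff.1 (hf b hb)
          exact ⟨insert_subset h1 (hF b hb).1, by rw [card_insert_of_notMem h2, (hF b hb).2]⟩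
        · have h1 : ({b ∈ S | a ∈ insert (f b) (F b)} : Finset β) ⊆
              {b ∈ S | a ∈ F b} ∪ {b ∈ S | f b = a} := by
            intro b hb
            simp only [mem_filter, mem_insert, mem_union] at hb ⊢
            rcases hb.2 with h | h
            · exact Or.inr ⟨hb.1, h.symm⟩
            · exact Or.inl ⟨hb.1, h⟩
          have h2 := (card_le_card h1).trans (card_union_le _ _)
          have h3 := hFM a
          have h4 := hfM a
          rw [add_mul, one_mul]
          dsimp only
          omega
      · refine Or.inr ⟨fun b => if b ∈ S then H b \ F b else H b, fun b => ?_, S', hS', ?_⟩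
        · dsimp only
          split_ifs with hb
          · refine ⟨sdiff_subset, ?_⟩
            have := le_card_sdiff (F b) (H b)
            rw [(hF b hb).2] at this
            omega
          · exact ⟨Subset.rfl, by omega⟩
        · convert h using 3
          exact biUnion_congr rfl fun b hb => if_pos (hS' hb)
    · exact Or.inr ⟨H', fun b => ⟨(hH' b).1, by have := (hH' b).2; omega⟩, h⟩

lemma isBiregular_product {T : Finset α} {U : Finset β} {k : ℕ} (hk : 0 < k) (hT : #T = k)
    (hU : #U = k) : IsBiregular (T ×ˢ U) k := by
  refine ⟨card_pos.1 (by rw [card_product, hT, hU]; positivity), ?_⟩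
  rintro ⟨a, b⟩ he
  obtain ⟨ha, hb⟩ := mem_product.1 he
  constructor
  · rw [← hU, leftDeg]
    refine card_nbij' (fun e => e.2) (fun b => (a, b)) ?_ ?_ ?_ ?_
    · intro e he
      exact (mem_product.1 (mem_filter.1 (mem_coe.1 he)).1).2
    · intro c hc
      simp only [coe_filter, mem_product, Set.mem_ofPred_eq]
      exact ⟨⟨ha, hc⟩, trivial⟩
    · rintro ⟨a', b'⟩ he
      have := (mem_filter.1 (mem_coe.1 he)).2
      simp_all
    · intro c _
      rfl
  · rw [← hT, rightDeg]
    refine card_nbij' (fun e => e.1) (fun a => (a, b)) ?_ ?_ ?_ ?_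
    · intro e he
      exact (mem_product.1 (mem_filter.1 (mem_coe.1 he)).1).1
    · intro c hc
      simp only [coe_filter, mem_product, Set.mem_ofPred_eq]
      exact ⟨⟨hc, hb⟩, trivial⟩
    · rintro ⟨a', b'⟩ he
      have := (mem_filter.1 (mem_coe.1 he)).2
      simp_all
    · intro c _
      rfl

/-- The side condition relating the density parameter `e` to the constants `k` and `R`. -/
def IsLargeExponent (k R e : ℕ) : Prop := R + (k * R ^ 2) ^ k * k ≤ e

/-- Members of the system `H` indexed by `S` outnumber the elements they contain by the factor
used in the density increment. -/
def IsDense (k R e : ℕ) (S : Finset β) (H : β → Finset α) : Prop :=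
  (R + 1) * (k * (R + 1) * 2 ^ e) ^ (R - 1) * #(S.biUnion H) < #S

/-- The system `H` indexed by `S` contains a `k`-regular bipartite graph. -/
def ContainsBiregular (k : ℕ) (S : Finset β) (H : β → Finset α) : Prop :=
  ∃ E : Finset (α × β), IsBiregular E k ∧ ∀ e ∈ E, e.2 ∈ S ∧ e.1 ∈ H e.2

lemma ContainsBiregular.mono {k : ℕ} {S S' : Finset β} {H H' : β → Finset α}
    (h : ContainsBiregular k S' H') (hS : S' ⊆ S) (hH : ∀ b ∈ S', H' b ⊆ H b) :
    ContainsBiregular k S H := by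
  obtain ⟨E, hE, h⟩ := h
  exact ⟨E, hE, fun e he => ⟨hS (h e he).1, hH _ (h e he).1 (h e he).2⟩⟩

lemma card_filter_subset_le_of_not_containsBiregular {k : ℕ} (hk : 0 < k) {S : Finset β}
    {H : β → Finset α} (h : ¬ ContainsBiregular k S H) (T : Finset α) (hT : #T = k) :
    #{b ∈ S | T ⊆ H b} ≤ k := by
  by_contra! hcon
  obtain ⟨U, hU, hUk⟩ := exists_subset_card_eq hcon.le
  refine h ⟨T ×ˢ U, isBiregular_product hk hT hUk, fun e he => ?_⟩
  obtain ⟨h1, h2⟩ := mem_product.1 he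
  obtain ⟨h3, h4⟩ := mem_filter.1 (hU h2)
  exact ⟨h3, h4 h1⟩

/-- The density increment. -/
lemma IsDense.exists_step [Fintype α] [Fintype β] {k q R e : ℕ} (hq : q.Prime) (hk : 0 < k)
    (hkq : k ≤ q) (hqR : (k + 2) * (6 * (2 * q - 1)) ^ 2 ≤ R) (he : IsLargeExponent k R e)
    {S : Finset β} {H : β → Finset α} (hSH : IsDense k R e S H)
    (hno : ¬ ContainsBiregular k S H) :
    ∃ S' ⊆ S, ∃ H' : β → Finset α, (∀ b, H' b ⊆ H b ∧ #(H b) ≤ #(H' b) + k * R) ∧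
      IsDense k R (e + e / R) S' H' := by
  have hS : S.Nonempty := card_pos.1 ((Nat.zero_le _).trans_lt hSH)
  have hR : 0 < R := by
    refine lt_of_lt_of_le ?_ hqR
    have : 0 < 2 * q - 1 := by have := hq.two_le; omega
    positivity
  unfold IsLargeExponent at he
  set N := k * (R + 1) * 2 ^ e with hN
  let M := (R + 1) * (k * (R + 1)) ^ (R - 1) * 2 ^ (e * R)
  have hkM : k * M = N ^ R := by
    obtain ⟨r, rfl⟩ : ∃ r, R = r + 1 := ⟨R - 1, by omega⟩
    simp only [M, hN, Nat.add_sub_cancel]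
    rw [mul_pow _ (2 ^ e), ← pow_mul, pow_succ (k * (r + 1 + 1)) r]
    ring
  have h2R : 2 ^ e ≤ N := Nat.le_mul_of_pos_left _ (by positivity)
  have he2 : e ≤ N := e.lt_two_pow_self.le.trans h2R
  obtain ⟨F, hF, hFM⟩ | ⟨H', hH', S', hS', h⟩ :=
    exists_bounded_system_or_obstruction hS H M (k * R)
  · refine absurd ?_ hno
    have hnoF : ¬ ContainsBiregular k S F := fun h =>
      hno (h.mono Subset.rfl fun b hb => (hF b hb).1)
    refine ContainsBiregular.mono (H' := F) (exists_isBiregular_of_bounded_degree (N := N)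
      (A := S.biUnion H) hq hk hkq hqR (by omega) ?_ (by omega) (fun b hb => (hF b hb).2)
      (fun b hb => (hF b hb).1.trans (subset_biUnion_of_mem H hb)) hSH (fun a => ?_)
      (card_filter_subset_le_of_not_containsBiregular hk hnoF)) Subset.rfl
        fun b hb => (hF b hb).1
    · calc 2 ^ R * k ≤ 2 ^ e * (k * (R + 1)) :=
            Nat.mul_le_mul (Nat.pow_le_pow_right two_pos (by omega)) (Nat.le_mul_of_pos_right _
              (by omega))
        _ = N := by rw [hN, mul_comm]
    · refine (hFM a).trans (le_of_eq ?_)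
      rw [← hkM]
      ring
  · refine ⟨S', hS', H', hH', lt_of_le_of_lt (Nat.mul_le_mul_right _ ?_) h⟩
    simp only [M]
    rw [mul_pow _ (2 ^ _), ← pow_mul, mul_assoc]
    refine Nat.mul_le_mul_left _ (Nat.mul_le_mul_left _ (Nat.pow_le_pow_right two_pos ?_))
    obtain ⟨r, rfl⟩ : ∃ r, R = r + 1 := ⟨R - 1, by omega⟩
    have := Nat.div_mul_le_self e (r + 1)
    simp only [Nat.add_sub_cancel]
    nlinarith

lemma IsDense.exists_iterate [Fintype α] [Fintype β] {k q R e : ℕ} (hq : q.Prime) (hk : 0 < k)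
    (hkq : k ≤ q) (hqR : (k + 2) * (6 * (2 * q - 1)) ^ 2 ≤ R) (he : IsLargeExponent k R e)
    {S : Finset β} {H : β → Finset α} (hSH : IsDense k R e S H)
    (hno : ¬ ContainsBiregular k S H) (n : ℕ) :
    ∃ S' ⊆ S, ∃ H' : β → Finset α, (∀ b, H' b ⊆ H b ∧ #(H b) ≤ #(H' b) + n * (k * R)) ∧
      ∃ e', e + n * (e / R) ≤ e' ∧ IsDense k R e' S' H' := by
  induction n with
  | zero => exact ⟨S, Subset.rfl, H, fun b => ⟨Subset.rfl, by simp⟩, e, by simp, hSH⟩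
  | succ n ih =>
    obtain ⟨S₁, hS₁, H₁, hH₁, e₁, he₁, h₁⟩ := ih
    have hee : e ≤ e₁ := by omega
    obtain ⟨S₂, hS₂, H₂, hH₂, h₂⟩ := h₁.exists_step hq hk hkq hqR (le_trans he hee)
      fun h => hno (h.mono hS₁ fun b _ => (hH₁ b).1)
    refine ⟨S₂, hS₂.trans hS₁, H₂, fun b => ⟨(hH₂ b).1.trans (hH₁ b).1, ?_⟩, _, ?_, h₂⟩
    · have h3 := (hH₁ b).2
      have h4 := (hH₂ b).2
      rw [add_mul, one_mul]
      omega
    · have := Nat.div_le_div_right (c := R) hee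
      rw [add_mul, one_mul]
      omega

lemma IsDense.exists_double [Fintype α] [Fintype β] {k q R e : ℕ} (hq : q.Prime) (hk : 0 < k)
    (hkq : k ≤ q) (hqR : (k + 2) * (6 * (2 * q - 1)) ^ 2 ≤ R) (he : IsLargeExponent k R e)
    {S : Finset β} {H : β → Finset α} (hSH : IsDense k R e S H)
    (hno : ¬ ContainsBiregular k S H) (j : ℕ) :
    ∃ S' ⊆ S, ∃ H' : β → Finset α,
      (∀ b, H' b ⊆ H b ∧ #(H b) ≤ #(H' b) + j * (2 * R * (k * R))) ∧
      ∃ e', 2 ^ j * e ≤ e' ∧ IsDense k R e' S' H' := by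
  have hR : 0 < R := by
    refine lt_of_lt_of_le ?_ hqR
    have : 0 < 2 * q - 1 := by have := hq.two_le; omega
    positivity
  induction j with
  | zero => exact ⟨S, Subset.rfl, H, fun b => ⟨Subset.rfl, by simp⟩, e, by simp, hSH⟩
  | succ j ih =>
    obtain ⟨S₁, hS₁, H₁, hH₁, e₁, he₁, h₁⟩ := ih
    have hee : e ≤ e₁ := (Nat.le_mul_of_pos_left _ (by positivity)).trans he₁
    obtain ⟨S₂, hS₂, H₂, hH₂, e₂, he₂, h₂⟩ := h₁.exists_iterate hq hk hkq hqR (le_trans he hee)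
      (fun h => hno (h.mono hS₁ fun b _ => (hH₁ b).1)) (2 * R)
    refine ⟨S₂, hS₂.trans hS₁, H₂, fun b => ⟨(hH₂ b).1.trans (hH₁ b).1, ?_⟩, e₂, ?_, h₂⟩
    · have h3 := (hH₁ b).2
      have h4 := (hH₂ b).2
      rw [add_mul, one_mul]
      omega
    · have hRe : R ≤ e₁ := by
        unfold IsLargeExponent at he
        omega
      have h5 : 1 ≤ e₁ / R := (Nat.one_le_div_iff hR).2 hRe
      have h6 := Nat.div_add_mod e₁ R
      have h7 := Nat.mod_lt e₁ hR
      have h8 : R * 1 ≤ R * (e₁ / R) := Nat.mul_le_mul_left _ h5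
      rw [mul_assoc] at he₂
      rw [pow_succ]
      nlinarith

/-- A dense system of sets of size of order `log log Δ` contains a `k`-regular bipartite graph. -/
lemma IsDense.containsBiregular [Fintype α] [Fintype β] {k q R e : ℕ} (hq : q.Prime) (hk : 0 < k)
    (hkq : k ≤ q) (hqR : (k + 2) * (6 * (2 * q - 1)) ^ 2 ≤ R) (he : IsLargeExponent k R e)
    {S : Finset β} {H : β → Finset α} (hSH : IsDense k R e S H) {j Δ : ℕ}
    (hΔ : ∀ a, #{b ∈ S | a ∈ H b} ≤ Δ) (hj : Δ ≤ 2 ^ 2 ^ j)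
    (hH : ∀ b ∈ S, j * (2 * R * (k * R)) < #(H b)) : ContainsBiregular k S H := by
  by_contra hno
  have hR : 2 ≤ R := by
    refine le_trans ?_ hqR
    have h0 : 0 < 2 * q - 1 := by have := hq.two_le; omega
    have : 0 < (6 * (2 * q - 1)) ^ 2 := by positivity
    nlinarith
  obtain ⟨S', hS', H', hH', e', he', h⟩ := hSH.exists_double hq hk hkq hqR he hno j
  have h1 : #S' ≤ Δ * #(S'.biUnion H') := by
    calc #S' ≤ ∑ b ∈ S', #(H' b) := by
          rw [card_eq_sum_ones]
          refine sum_le_sum fun b hb => ?_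
          have h3 := hH b (hS' hb)
          have h4 := (hH' b).2
          omega
      _ = ∑ a ∈ S'.biUnion H', #{b ∈ S' | a ∈ H' b} := by
          have := sum_card_bipartiteAbove_eq_sum_card_bipartiteBelow
            (s := S'.biUnion H') (t := S') fun a b => a ∈ H' b
          simp only [bipartiteAbove, bipartiteBelow] at this
          rw [this]
          refine sum_congr rfl fun b hb => ?_
          rw [filter_mem_eq_inter, inter_eq_right.2 (subset_biUnion_of_mem H' hb)]
      _ ≤ #(S'.biUnion H') * Δ := by
          rw [← smul_eq_mul]
          refine sum_le_card_nsmul _ _ _ fun a _ => (card_le_card fun b hb => ?_).trans (hΔ a)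
          simp only [mem_filter] at hb ⊢
          exact ⟨hS' hb.1, (hH' b).1 hb.2⟩
      _ = Δ * #(S'.biUnion H') := mul_comm _ _
  have h2 : (R + 1) * (k * (R + 1) * 2 ^ e') ^ (R - 1) < Δ :=
    Nat.lt_of_mul_lt_mul_right (h.trans_le h1)
  refine absurd (h2.trans_le hj) (not_lt.2 ?_)
  have he1 : 1 ≤ e := by
    unfold IsLargeExponent at he
    omega
  have h3 : 2 ^ j ≤ e' := (Nat.le_mul_of_pos_right _ he1).trans he'
  calc 2 ^ 2 ^ j ≤ 2 ^ e' := Nat.pow_le_pow_right two_pos h3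
    _ ≤ k * (R + 1) * 2 ^ e' := Nat.le_mul_of_pos_left _ (by positivity)
    _ ≤ (k * (R + 1) * 2 ^ e') ^ (R - 1) := Nat.le_self_pow (by omega) _
    _ ≤ _ := Nat.le_mul_of_pos_left _ (by omega)

end Bipartite

section Sampling

variable {V : Type*} [Fintype V] [DecidableEq V]

lemma expect_sq_sub_mean_le (p : ℝ) (W : Finset V) :
    expect (fun _ => p) (fun ω => (#(W ∩ ω) - p * #W) ^ 2) ≤ p * #W := by
  set μ := p * #W with hμ
  have hX : ∀ ω : Finset V, (#(W ∩ ω) : ℝ) = ∑ u ∈ W, if {u} ⊆ ω then 1 else 0 := fun ω => by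
    simp only [singleton_subset_iff, sum_boole]
    rw [filter_mem_eq_inter]
  have hXX : ∀ ω : Finset V, (#(W ∩ ω) : ℝ) * #(W ∩ ω) =
      ∑ u ∈ W, ∑ w ∈ W, if {u, w} ⊆ ω then 1 else 0 := fun ω => by
    rw [hX, sum_mul_sum]
    refine sum_congr rfl fun u _ => sum_congr rfl fun w _ => ?_
    by_cases hu : u ∈ ω <;> by_cases hw : w ∈ ω <;> simp [insert_subset_iff, hu, hw]
  have h1 : expect (fun _ => p) (fun ω => (#(W ∩ ω) - μ) ^ 2) =
      (∑ u ∈ W, ∑ w ∈ W, p ^ #{u, w}) - (2 * μ * ∑ u ∈ W, p - μ ^ 2) := by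
    have h2 : (fun ω : Finset V => ((#(W ∩ ω) : ℝ) - μ) ^ 2) = fun ω =>
        (∑ u ∈ W, ∑ w ∈ W, if {u, w} ⊆ ω then 1 else 0) -
          (2 * μ * (∑ u ∈ W, if {u} ⊆ ω then 1 else 0) - μ ^ 2) := by
      funext ω
      rw [← hXX, ← hX]
      ring
    rw [h2, expect_sub, expect_sub, expect_const_mul, expect_sum, expect_sum, expect_const]
    simp only [expect_sum, expect_subset, prod_const, card_singleton, pow_one]
  have h3 : ∀ u ∈ W, ∑ w ∈ W, p ^ #{u, w} ≤ p + #W * p ^ 2 := by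
    intro u hu
    rw [← add_sum_erase W _ hu]
    refine add_le_add (by simp) ?_
    refine (sum_le_card_nsmul _ _ (p ^ 2) fun w hw => ?_).trans ?_
    · rw [card_pair (ne_of_mem_erase hw).symm]
    · rw [nsmul_eq_mul]
      exact mul_le_mul_of_nonneg_right (by exact_mod_cast card_le_card (erase_subset _ _))
        (by positivity)
  have h4 := sum_le_card_nsmul _ _ _ h3
  rw [h1, sum_const, nsmul_eq_mul]
  rw [nsmul_eq_mul] at h4
  nlinarith

/-- In a graph of large minimum degree there is a small set `A` such that many vertices outside
`A` have many neighbours in `A`. -/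
lemma exists_dominating_subset {U : Finset V} (hU : U.Nonempty) {nbr : V → Finset V} {L t : ℕ}
    (hL : 0 < L) (ht : 8 ≤ t) (hnbr : ∀ v ∈ U, 8 * L * t ≤ #(nbr v ∩ U)) :
    ∃ A ⊆ U, ∃ B ⊆ U \ A, L * #A < #B ∧ ∀ b ∈ B, t ≤ #(nbr b ∩ A) := by
  choose! W hW hWc using fun v (hv : v ∈ U) => exists_subset_card_eq (hnbr v hv)
  have hL' : (1 : ℝ) ≤ L := by exact_mod_cast hL
  have ht' : (8 : ℝ) ≤ t := by exact_mod_cast ht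
  let p : ℝ := 1 / (4 * L)
  have hp0 : 0 < p := by positivity
  have hp4 : L * p = 1 / 4 := by
    simp only [p]
    field_simp
  have hp1 : p ≤ 1 / 4 := by nlinarith
  have hμ : ∀ v ∈ U, p * #(W v) = 2 * t := fun v hv => by
    rw [hWc v hv]
    push_cast
    linear_combination 8 * t * hp4
  let J : V → Finset V → ℝ := fun v ω => if {v} ⊆ ω then 1 else 0
  let Y : V → Finset V → ℝ := fun v ω => 1 - (J v ω + 1 / t ^ 2 * (#(W v ∩ ω) - p * #(W v)) ^ 2)
  have hpos : 0 < expect (fun _ => p) (fun ω => ∑ v ∈ U, Y v ω - L * ∑ v ∈ U, J v ω) := by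
    have hJ : ∀ v, expect (fun _ => p) (J v) = p := fun v => by
      have := expect_subset (fun _ : V => p) {v}
      rwa [prod_singleton] at this
    have hY : ∀ v ∈ U, 1 / 2 ≤ expect (fun _ => p) (Y v) := by
      intro v hv
      simp only [Y]
      rw [expect_sub, expect_add, expect_const, expect_const_mul, hJ]
      have h1 := expect_sq_sub_mean_le p (W v)
      rw [hμ v hv] at h1 ⊢
      have h2 := mul_le_mul_of_nonneg_left h1 (by positivity : (0 : ℝ) ≤ 1 / t ^ 2)
      have h3 : 1 / (t : ℝ) ^ 2 * (2 * t) ≤ 1 / 4 := by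
        rw [div_mul_eq_mul_div, one_mul, div_le_div_iff₀ (by positivity) (by norm_num)]
        nlinarith
      linarith
    rw [expect_sub, expect_sum, expect_const_mul, expect_sum]
    simp only [hJ]
    have h1 := card_nsmul_le_sum _ _ _ hY
    rw [sum_const, nsmul_eq_mul] at *
    have hU' : (0 : ℝ) < #U := by exact_mod_cast hU.card_pos
    nlinarith
  obtain ⟨ω, hω⟩ := exists_pos_of_expect_pos (fun _ => hp0.le) (fun _ => by linarith) hpos
  refine ⟨U ∩ ω, inter_subset_left, {v ∈ U \ (U ∩ ω) | t ≤ #(nbr v ∩ (U ∩ ω))},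
    filter_subset _ _, ?_, fun b hb => (mem_filter.1 hb).2⟩
  have hJ : ∑ v ∈ U, J v ω = #(U ∩ ω) := by
    simp only [J, singleton_subset_iff, sum_boole]
    rw [filter_mem_eq_inter]
  have hY : ∑ v ∈ U, Y v ω ≤ #{v ∈ U \ (U ∩ ω) | t ≤ #(nbr v ∩ (U ∩ ω))} := by
    have h1 : ({v ∈ U \ (U ∩ ω) | t ≤ #(nbr v ∩ (U ∩ ω))} : Finset V) =
        {v ∈ U | v ∉ ω ∧ t ≤ #(nbr v ∩ (U ∩ ω))} := by
      ext v
      simp only [mem_filter, mem_sdiff, mem_inter]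
      tauto
    rw [h1, ← sum_boole]
    refine sum_le_sum fun v hv => ?_
    simp only [Y, J, singleton_subset_iff]
    have h0 : 0 ≤ 1 / (t : ℝ) ^ 2 * (#(W v ∩ ω) - p * #(W v)) ^ 2 := by positivity
    by_cases hvω : v ∈ ω
    · rw [if_pos hvω, if_neg fun h => h.1 hvω]
      linarith
    · rw [if_neg hvω]
      by_cases hc : t ≤ #(nbr v ∩ (U ∩ ω))
      · rw [if_pos ⟨hvω, hc⟩]
        linarith
      · rw [if_neg fun h => hc h.2, hμ v hv]
        have h2 : #(W v ∩ ω) ≤ #(nbr v ∩ (U ∩ ω)) := by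
          rw [← inter_assoc]
          exact card_le_card (inter_subset_inter_right (hW v hv))
        have h3 : (#(W v ∩ ω) : ℝ) ≤ t := by exact_mod_cast h2.trans (not_le.1 hc).le
        have h4 : 1 ≤ 1 / (t : ℝ) ^ 2 * (#(W v ∩ ω) - 2 * t) ^ 2 := by
          rw [div_mul_eq_mul_div, one_mul, le_div_iff₀ (by positivity), one_mul]
          nlinarith
        linarith
  rw [hJ] at hω
  have : (L : ℝ) * #(U ∩ ω) < #{v ∈ U \ (U ∩ ω) | t ≤ #(nbr v ∩ (U ∩ ω))} := by linarith
  exact_mod_cast this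

/-- A graph of large average degree contains an induced subgraph of large minimum degree. -/
lemma exists_min_degree_subset {nbr : V → Finset V} (hsymm : ∀ u v, u ∈ nbr v → v ∈ nbr u) {t : ℕ}
    (h : 2 * t * Fintype.card V < ∑ v, #(nbr v)) :
    ∃ U : Finset V, U.Nonempty ∧ ∀ v ∈ U, t ≤ #(nbr v ∩ U) := by
  obtain ⟨U, -, hmax⟩ := exists_max_image univ
    (fun U : Finset V => (∑ v ∈ U, (#(nbr v ∩ U) : ℤ)) - 2 * t * #U) ⟨univ, mem_univ _⟩
  refine ⟨U, ?_, fun v hv => ?_⟩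
  · by_contra hU
    have h1 := hmax univ (mem_univ _)
    rw [not_nonempty_iff_eq_empty.1 hU] at h1
    simp only [inter_univ, card_univ, sum_empty, card_empty] at h1
    zify at h
    push_cast at h1
    linarith
  · have h1 := hmax (U.erase v) (mem_univ _)
    rw [cast_card_erase_of_mem hv] at h1
    have h2 : ∑ u ∈ U, (#(nbr u ∩ U) : ℤ) =
        (∑ u ∈ U.erase v, (#(nbr u ∩ U.erase v) : ℤ)) + #(nbr v ∩ U.erase v) +
          #(nbr v ∩ U) := by
      rw [← add_sum_erase U _ hv]
      have h3 : ∀ u ∈ U.erase v, (#(nbr u ∩ U) : ℤ) =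
          #(nbr u ∩ U.erase v) + if u ∈ nbr v then 1 else 0 := by
        intro u hu
        split_ifs with huv
        · have hm : v ∈ nbr u ∩ U := mem_inter.2 ⟨hsymm _ _ huv, hv⟩
          rw [inter_erase, cast_card_erase_of_mem hm]
          ring
        · rw [inter_erase, erase_eq_of_notMem, add_zero]
          exact fun hm => huv (hsymm _ _ (mem_inter.1 hm).1)
      rw [sum_congr rfl h3, sum_add_distrib, sum_boole, filter_mem_eq_inter, inter_comm (nbr v)
        (U.erase v)]
      ring
    have h4 : (#(nbr v ∩ U.erase v) : ℤ) ≤ #(nbr v ∩ U) := by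
      exact_mod_cast card_le_card (inter_subset_inter_left (erase_subset _ _))
    zify
    linarith

end Sampling

section Graph

variable {V : Type*} [Fintype V]

lemma sum_deg_eq_two_mul_edgeCount (G : SimpleGraph V) : ∑ v, deg G v = 2 * edgeCount G := by
  classical
  have h := G.sum_degrees_eq_twice_card_edges
  rw [edgeCount, ← SimpleGraph.coe_edgeFinset, Set.ncard_coe_finset, ← h]
  refine sum_congr rfl fun v _ => ?_
  rw [deg, ← SimpleGraph.card_neighborSet_eq_degree, Set.ncard_eq_toFinset_card']
  simp

/-- A `k`-regular bipartite set of edges of `G` gives a `k`-regular subgraph. -/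
lemma IsBiregular.hasRegularSubgraph {V : Type*} [DecidableEq V] {G : SimpleGraph V} {k : ℕ}
    {E : Finset (V × V)} (hE : IsBiregular E k) {A : Finset V}
    (hEA : ∀ e ∈ E, e.1 ∈ A ∧ e.2 ∉ A ∧ G.Adj e.1 e.2) : HasRegularSubgraph G k := by
  let H : G.Subgraph :=
    { verts := {v | ∃ e ∈ E, v = e.1 ∨ v = e.2}
      Adj := fun u v => (u, v) ∈ E ∨ (v, u) ∈ E
      adj_sub := by
        rintro u v (h | h)
        · exact (hEA _ h).2.2
        · exact (hEA _ h).2.2.symm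
      edge_vert := by
        rintro u v (h | h)
        · exact ⟨_, h, Or.inl rfl⟩
        · exact ⟨_, h, Or.inr rfl⟩
      symm := ⟨fun _ _ h => h.symm⟩ }
  refine ⟨H, ?_, ?_⟩
  · obtain ⟨e, he⟩ := hE.1
    exact ⟨e.1, e, he, Or.inl rfl⟩
  · rintro v ⟨e, he, rfl | rfl⟩
    · rw [← (hE.2 e he).1, subDeg, leftDeg]
      have : H.neighborSet e.1 = (({f ∈ E | f.1 = e.1}).image Prod.snd : Finset V) := by
        ext w
        simp only [SimpleGraph.Subgraph.mem_neighborSet, coe_image, coe_filter, Set.mem_image,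
          Set.mem_ofPred_eq, Prod.exists]
        constructor
        · rintro (h | h)
          · exact ⟨_, _, ⟨h, rfl⟩, rfl⟩
          · exact absurd (hEA e he).1 (hEA _ h).2.1
        · rintro ⟨a, b, ⟨h, rfl⟩, rfl⟩
          exact Or.inl h
      rw [this, Set.ncard_coe_finset, card_image_of_injOn]
      intro f hf f' hf' hff
      exact Prod.ext (((mem_filter.1 hf).2).trans ((mem_filter.1 hf').2).symm) hff
    · rw [← (hE.2 e he).2, subDeg, rightDeg]
      have : H.neighborSet e.2 = (({f ∈ E | f.2 = e.2}).image Prod.fst : Finset V) := by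
        ext w
        simp only [SimpleGraph.Subgraph.mem_neighborSet, coe_image, coe_filter, Set.mem_image,
          Set.mem_ofPred_eq, Prod.exists]
        constructor
        · rintro (h | h)
          · exact absurd (hEA _ h).1 (hEA e he).2.1
          · exact ⟨_, _, ⟨h, rfl⟩, rfl⟩
        · rintro ⟨a, b, ⟨h, rfl⟩, rfl⟩
          exact Or.inr h
      rw [this, Set.ncard_coe_finset, card_image_of_injOn]
      intro f hf f' hf' hff
      exact Prod.ext hff (((mem_filter.1 hf).2).trans ((mem_filter.1 hf').2).symm)

/-- A graph of maximum degree at most `2 ^ 2 ^ j` with average degree of order `j` contains a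
`k`-regular subgraph. -/
lemma exists_hasRegularSubgraph_of_sum_deg {k : ℕ} (hk : 0 < k) :
    ∃ c : ℕ, ∀ (V : Type) [Fintype V] (G : SimpleGraph V) (Δ j : ℕ), (∀ v, deg G v ≤ Δ) →
      Δ ≤ 2 ^ 2 ^ j → c * (j + 1) * Fintype.card V < ∑ v, deg G v → HasRegularSubgraph G k := by
  obtain ⟨q, hkq, hq⟩ := Nat.exists_infinite_primes k
  obtain ⟨R, hR⟩ : ∃ R, (k + 2) * (6 * (2 * q - 1)) ^ 2 = R := ⟨_, rfl⟩
  obtain ⟨e, he⟩ : ∃ e, R + (k * R ^ 2) ^ k * k = e := ⟨_, rfl⟩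
  have hR0 : 0 < R := by
    rw [← hR]
    have : 0 < 2 * q - 1 := by have := hq.two_le; omega
    positivity
  obtain ⟨L, hL⟩ : ∃ L, (R + 1) * (k * (R + 1) * 2 ^ e) ^ (R - 1) = L := ⟨_, rfl⟩
  have hL0 : 0 < L := by
    rw [← hL]
    positivity
  obtain ⟨D, hD⟩ : ∃ D, 2 * R * (k * R) = D := ⟨_, rfl⟩
  refine ⟨2 * (8 * L * (D + 8)), fun V _ G Δ j hΔ hj hsum => ?_⟩
  classical
  let nbr : V → Finset V := fun v => {w | G.Adj v w}
  have hdeg : ∀ v, deg G v = #(nbr v) := fun v => by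
    rw [deg, ← Set.ncard_coe_finset]
    congr 1
    ext w
    simp [nbr]
  have hsymm : ∀ u v, u ∈ nbr v → v ∈ nbr u := fun u v h => by
    simpa [nbr, G.adj_comm] using h
  obtain ⟨U, hU, hUmin⟩ := exists_min_degree_subset (t := 8 * L * ((D + 8) * (j + 1))) hsymm (by
    simp only [hdeg] at hsum
    refine lt_of_eq_of_lt ?_ hsum
    ring)
  obtain ⟨A, -, B, hB, hAB, hBdeg⟩ := exists_dominating_subset hU hL0 (by nlinarith) hUmin
  have hdense : IsDense k R e B fun b => nbr b ∩ A := by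
    unfold IsDense
    rw [hL]
    refine lt_of_le_of_lt (Nat.mul_le_mul_left _ (card_le_card ?_)) hAB
    exact biUnion_subset.2 fun b _ => inter_subset_right
  obtain ⟨E, hE, h⟩ := hdense.containsBiregular hq hk hkq hR.le he.le (j := j) (Δ := Δ)
    (fun a => by
      refine (card_le_card fun b hb => ?_).trans ((hdeg a).ge.trans (hΔ a))
      exact hsymm _ _ (mem_inter.1 (mem_filter.1 hb).2).1) hj
    (fun b hb => by
      rw [hD]
      have := hBdeg b hb
      nlinarith)
  refine hE.hasRegularSubgraph (A := A) fun f hf => ⟨(mem_inter.1 (h f hf).2).2,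
    (mem_sdiff.1 (hB (h f hf).1)).2, ?_⟩
  have := (mem_filter.1 (mem_inter.1 (h f hf).2).1).2
  exact this.symm

end Graph

end ErdosSauer

/-- Erdős–Sauer: for every positive integer `k` there is `C = C(k)` such that every graph
with maximum degree `Δ ≥ 4` and average degree at least `C · log₂ log₂ Δ` contains a
nonempty `k`-regular subgraph. -/
theorem erdos_sauer_loglog (k : ℕ) (hk : 0 < k) :
    ∃ C : ℝ, ∀ (V : Type) [Fintype V] (G : SimpleGraph V) (Δ : ℕ),
      4 ≤ Δ → (∀ v, deg G v ≤ Δ) →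
      C * Real.logb 2 (Real.logb 2 (Δ : ℝ)) ≤ avgDeg G →
      HasRegularSubgraph G k := by
  obtain ⟨c, hc⟩ := ErdosSauer.exists_hasRegularSubgraph_of_sum_deg hk
  refine ⟨3 * c + 1, fun V _ G Δ hΔ4 hΔ havg => ?_⟩
  obtain ⟨l, hl⟩ : ∃ l, Real.logb 2 (Real.logb 2 (Δ : ℝ)) = l := ⟨_, rfl⟩
  rw [hl] at havg
  have hΔ4' : (4 : ℝ) ≤ Δ := by exact_mod_cast hΔ4
  have hlog2 : 2 ≤ Real.logb 2 (Δ : ℝ) := by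
    rw [Real.le_logb_iff_rpow_le one_lt_two (by linarith)]
    norm_num
    exact hΔ4
  have hl1 : 1 ≤ l := by
    rw [← hl, Real.le_logb_iff_rpow_le one_lt_two (by linarith)]
    simpa using hlog2
  have hj : Δ ≤ 2 ^ 2 ^ ⌈l⌉₊ := by
    have h1 : Real.logb 2 (Δ : ℝ) ≤ (2 : ℝ) ^ ⌈l⌉₊ := by
      rw [← Real.rpow_natCast, ← Real.logb_le_iff_le_rpow one_lt_two (by linarith), hl]
      exact Nat.le_ceil l
    have h2 : (Δ : ℝ) ≤ 2 ^ 2 ^ ⌈l⌉₊ := by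
      rw [← Real.rpow_natCast, ← Real.logb_le_iff_le_rpow one_lt_two (by linarith)]
      push_cast
      exact h1
    exact_mod_cast h2
  have hj' : (⌈l⌉₊ : ℝ) < l + 1 := Nat.ceil_lt_add_one (by linarith)
  refine hc V G Δ _ hΔ hj ?_
  have hc0 : (0 : ℝ) ≤ c := Nat.cast_nonneg c
  have havg0 : 0 < avgDeg G := lt_of_lt_of_le (by positivity) havg
  have hV : (0 : ℝ) < Fintype.card V := by
    rcases (Nat.cast_nonneg (Fintype.card V) : (0 : ℝ) ≤ _).eq_or_lt with h | h
    · rw [avgDeg, ← h, div_zero] at havg0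
      exact absurd havg0 (lt_irrefl 0)
    · exact h
  rw [avgDeg, le_div_iff₀ hV] at havg
  rw [ErdosSauer.sum_deg_eq_two_mul_edgeCount]
  have h1 : (c : ℝ) * (⌈l⌉₊ + 1) < (3 * c + 1) * l := by nlinarith
  have h2 := mul_lt_mul_of_pos_right h1 hV
  have h3 : ((c * (⌈l⌉₊ + 1) * Fintype.card V : ℕ) : ℝ) < ((2 * edgeCount G : ℕ) : ℝ) := by
    push_cast
    linarith
  exact_mod_cast h3
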